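/- Let H be a perfect non-zero-dimensional Polish space and G a dense G_δ subset of H such that for every dense subset D of G the space H ∖ D is zero-dimensional. Then for every countable ordinal ξ ≥ 3 there exists a Π⁰_ξ set X ⊂ ω^ω × H such that F₀(X) is Game Σ⁰_ξ-hard. If moreover G is nowhere relatively σ-compact in H (i.e. no nonempty relatively open subset of G is contained in a σ-compact subset of H), then the same conclusion holds for ξ = 2. -/

import Mathlib

open Set Filter Topology TopologicalSpace

/-- `DimLE X n` : the topological (covering) dimension of `X` is at most `n`, i.e. every
finite open cover of `X` admits an open shrinking (refinement) of order at most `n + 1`. -/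
def DimLE (X : Type*) [TopologicalSpace X] (n : ℕ) : Prop :=
  ∀ (k : ℕ) (U : Fin k → Set X), (∀ i, IsOpen (U i)) → (⋃ i, U i) = Set.univ →
    ∃ V : Fin k → Set X, (∀ i, IsOpen (V i)) ∧ (∀ i, V i ⊆ U i) ∧ (⋃ i, V i) = Set.univ ∧
      ∀ x : X, ({i | x ∈ V i}).ncard ≤ n + 1

/-- The collection `F(X)` of closed subsets of `X`. -/
abbrev Cl (X : Type*) [TopologicalSpace X] : Type _ := {F : Set X // IsClosed F}

/-- `F₀(X)` : the set of all closed zero-dimensional subsets of `X`. -/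
def F0 (X : Type*) [TopologicalSpace X] : Set (Cl X) := {F | DimLE (↥F.1) 0}

/-- The Vietoris topology on subsets of `Y`. -/
def vietoris (Y : Type*) [TopologicalSpace Y] : TopologicalSpace (Set Y) :=
  TopologicalSpace.generateFrom
    ({S | ∃ U : Set Y, IsOpen U ∧ S = {A : Set Y | A ⊆ U}} ∪
     {S | ∃ U : Set Y, IsOpen U ∧ S = {A : Set Y | (A ∩ U).Nonempty}})

/-- A topology `τ` on `F(X)` is admissible if it is induced, via `F ↦ closure (e '' F)`,
by the Vietoris topology on some metrizable compactification `Y` of `X` (with embedding `e`). -/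
def IsAdmissible (X : Type*) [tX : TopologicalSpace X] (τ : TopologicalSpace (Cl X)) : Prop :=
  ∃ (Y : Type) (tY : TopologicalSpace Y) (_ : @CompactSpace Y tY)
    (_ : @TopologicalSpace.MetrizableSpace Y tY) (e : X → Y),
      @Topology.IsEmbedding X Y tX tY e ∧
      τ = (@vietoris Y tY).induced (fun F : Cl X => @closure Y tY (e '' F.1))

/-- An analytic space: a separable metrizable space which is empty or a continuous image
of the Baire space `ℕ → ℕ`. -/
def IsAnalyticSpace (X : Type*) [TopologicalSpace X] : Prop :=
  TopologicalSpace.MetrizableSpace X ∧ TopologicalSpace.SeparableSpace X ∧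
    (IsEmpty X ∨ ∃ f : (ℕ → ℕ) → X, Continuous f ∧ Function.Surjective f)

/-- `Σ¹₂` subsets of a topological space: projections of co-analytic sets. -/
def IsSigma12 {W : Type*} [TopologicalSpace W] (s : Set W) : Prop :=
  ∃ B : Set (W × (ℕ → ℕ)), MeasureTheory.AnalyticSet Bᶜ ∧ s = {w | ∃ y, (w, y) ∈ B}

/-- `Σ¹₂`-hardness (with Cantor space `2^ω = ℕ → Bool` as source). -/
def Sigma12Hard {W : Type*} [TopologicalSpace W] (A : Set W) : Prop :=
  ∀ A' : Set (ℕ → Bool), IsSigma12 A' →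
    ∃ φ : (ℕ → Bool) → W, Continuous φ ∧ A' = φ ⁻¹' A

/-- `Π¹₁`-hardness. -/
def Pi11Hard {W : Type*} [TopologicalSpace W] (A : Set W) : Prop :=
  ∀ A' : Set (ℕ → Bool), MeasureTheory.AnalyticSet A'ᶜ →
    ∃ φ : (ℕ → Bool) → W, Continuous φ ∧ A' = φ ⁻¹' A

/-- The additive Borel classes `Σ⁰ξ` : `Σ⁰₁` consists of the open sets, and for `ξ > 1`,
`Σ⁰ξ` consists of countable unions of sets whose complements are in some `Σ⁰η`, `η < ξ`. -/
inductive SigmaOrd {W : Type*} [TopologicalSpace W] : Ordinal.{0} → Set W → Prop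
  | basic (s : Set W) : IsOpen s → SigmaOrd 1 s
  | union (ξ : Ordinal.{0}) (η : ℕ → Ordinal.{0}) (f : ℕ → Set W) (hξ : 1 < ξ)
      (hη : ∀ n, η n < ξ) (h : ∀ n, SigmaOrd (η n) (f n)ᶜ) : SigmaOrd ξ (⋃ n, f n)

/-- The run produced when player I follows the strategy `σ` and player II plays `β`. -/
def playI (σ : List ℕ → ℕ) (β : ℕ → ℕ) : ℕ → ℕ := fun n =>
  if n % 2 = 0 then σ (List.ofFn fun i : Fin (n / 2) => β i) else β (n / 2)

/-- Player I has a winning strategy in the game `G_A`. -/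
def PlayerIWins (A : Set (ℕ → ℕ)) : Prop :=
  ∃ σ : List ℕ → ℕ, ∀ β : ℕ → ℕ, playI σ β ∈ A

/-- The game operator `Game B` applied to `B ⊆ W × ω^ω`. -/
def GameOp {W : Type*} (B : Set (W × (ℕ → ℕ))) : Set W :=
  {w | PlayerIWins {γ | (w, γ) ∈ B}}

/-- `Game Σ⁰ξ`-hardness. -/
def GameSigmaHard (ξ : Ordinal.{0}) {W : Type*} [TopologicalSpace W] (A : Set W) : Prop :=
  ∀ A' : Set (ℕ → Bool),
    (∃ B : Set ((ℕ → Bool) × (ℕ → ℕ)), SigmaOrd ξ B ∧ A' = GameOp B) →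
    ∃ φ : (ℕ → Bool) → W, Continuous φ ∧ A' = φ ⁻¹' A

namespace SigmaOrd

variable {W W' : Type*} [TopologicalSpace W] [TopologicalSpace W']

lemma one_le {ξ : Ordinal.{0}} {s : Set W} (h : SigmaOrd ξ s) : 1 ≤ ξ := by
  cases h with
  | basic _ _ => exact le_rfl
  | union _ _ _ hξ _ _ => exact hξ.le

lemma exists_iUnion {ξ : Ordinal.{0}} {s : Set W} (h : SigmaOrd ξ s) (hξ : 1 < ξ) :
    ∃ (η : ℕ → Ordinal.{0}) (f : ℕ → Set W), (∀ n, η n < ξ) ∧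
      (∀ n, SigmaOrd (η n) (f n)ᶜ) ∧ s = ⋃ n, f n := by
  cases h with
  | basic _ _ => exact absurd hξ (lt_irrefl _)
  | union _ η f _ hη h => exact ⟨η, f, hη, h, rfl⟩

lemma isOpen {s : Set W} (h : SigmaOrd 1 s) : IsOpen s := by
  generalize h1 : (1 : Ordinal.{0}) = ξ at h
  cases h with
  | basic _ hs => exact hs
  | union _ _ _ hξ _ _ => exact absurd hξ (by rw [← h1]; exact lt_irrefl _)

lemma preimage {ξ : Ordinal.{0}} {s : Set W} (h : SigmaOrd ξ s) {f : W' → W}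
    (hf : Continuous f) : SigmaOrd ξ (f ⁻¹' s) := by
  induction h with
  | basic s hs => exact .basic _ (hs.preimage hf)
  | union ξ η g hξ hη _ ih =>
    rw [preimage_iUnion]
    exact .union ξ η _ hξ hη ih

/-- A set which is `Σ⁰ξ` for an induced topology is the trace of a `Σ⁰ξ` set. -/
lemma exists_preimage_eq {ξ : Ordinal.{0}} {s : Set W'} (h : SigmaOrd ξ s) {f : W' → W}
    (hf : IsInducing f) : ∃ t : Set W, SigmaOrd ξ t ∧ f ⁻¹' t = s := by
  induction h with
  | basic s hs =>
    obtain ⟨t, ht, rfl⟩ := hf.isOpen_iff.1 hs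
    exact ⟨t, .basic _ ht, rfl⟩
  | union ξ η g hξ hη _ ih =>
    choose t ht hts using ih
    refine ⟨⋃ n, (t n)ᶜ, .union ξ η _ hξ hη (by simpa using ht), ?_⟩
    rw [preimage_iUnion]
    exact iUnion_congr fun n => by rw [preimage_compl, hts, compl_compl]

lemma of_isClosed_iUnion {f : ℕ → Set W} (hf : ∀ n, IsClosed (f n)) :
    SigmaOrd 2 (⋃ n, f n) :=
  .union 2 (fun _ => 1) f one_lt_two (fun _ => one_lt_two)
    fun n => .basic _ (hf n).isOpen_compl

lemma of_isClosed {s : Set W} (hs : IsClosed s) : SigmaOrd 2 s := by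
  simpa only [iUnion_const] using of_isClosed_iUnion (fun _ : ℕ => hs)

lemma of_isGδ {s : Set W} (hs : IsGδ s) : SigmaOrd 3 s := by
  obtain ⟨f, hf, rfl⟩ := isGδ_iff_eq_iInter_nat.1 hs
  have h2 : SigmaOrd 2 (⋂ n, f n)ᶜ := by
    rw [compl_iInter]
    exact of_isClosed_iUnion fun n => (hf n).isClosed_compl
  have h3 : (2 : Ordinal.{0}) < 3 := by exact_mod_cast (by norm_num : (2 : ℕ) < 3)
  simpa only [iUnion_const] using SigmaOrd.union 3 (fun _ => 2) (fun _ : ℕ => ⋂ n, f n)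
    (one_lt_two.trans h3) (fun _ => h3) fun _ => h2

lemma mono [PseudoMetrizableSpace W] {ξ ξ' : Ordinal.{0}} {s : Set W} (h : SigmaOrd ξ s)
    (hle : ξ ≤ ξ') : SigmaOrd ξ' s := by
  cases h with
  | basic _ hs =>
    rcases hle.eq_or_lt with rfl | hlt
    · exact .basic _ hs
    · let := pseudoMetrizableSpacePseudoMetric W
      obtain ⟨f, hf, hfs⟩ := isGδ_iff_eq_iInter_nat.1 hs.isClosed_compl.isGδ
      have : s = ⋃ n, (f n)ᶜ := by rw [← compl_iInter, ← hfs, compl_compl]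
      rw [this]
      exact .union ξ' (fun _ => 1) _ hlt (fun _ => hlt) fun n => by
        rw [compl_compl]; exact .basic _ (hf n)
  | union _ η f hξ hη hf =>
    exact .union ξ' η f (hξ.trans_le hle) (fun n => (hη n).trans_le hle) hf

lemma iUnion {ξ : Ordinal.{0}} {s : ℕ → Set W} (h : ∀ n, SigmaOrd ξ (s n)) :
    SigmaOrd ξ (⋃ n, s n) := by
  rcases (h 0).one_le.eq_or_lt with rfl | hξ
  · exact .basic _ (isOpen_iUnion fun n => (h n).isOpen)
  · choose η f hη hf hs using fun n => (h n).exists_iUnion hξ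
    have : ⋃ n, s n = ⋃ k : ℕ, f k.unpair.1 k.unpair.2 := by
      rw [Set.iUnion_unpair (fun i j => f i j)]
      exact iUnion_congr hs
    rw [this]
    exact .union ξ (fun k => η k.unpair.1 k.unpair.2) _ hξ (fun k => hη _ _) fun k => hf _ _

lemma union' {ξ : Ordinal.{0}} {s t : Set W} (hs : SigmaOrd ξ s) (ht : SigmaOrd ξ t) :
    SigmaOrd ξ (s ∪ t) := by
  have : s ∪ t = ⋃ n : ℕ, if n = 0 then s else t := by
    ext x
    simp only [mem_union, mem_iUnion]
    constructor
    · rintro (h | h)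
      exacts [⟨0, by simpa⟩, ⟨1, by simpa⟩]
    · rintro ⟨n, hn⟩
      split_ifs at hn
      exacts [.inl hn, .inr hn]
  rw [this]
  refine iUnion fun n => ?_
  split_ifs
  exacts [hs, ht]

lemma inter [PseudoMetrizableSpace W] {ξ : Ordinal.{0}} {s t : Set W} (hs : SigmaOrd ξ s)
    (ht : SigmaOrd ξ t) : SigmaOrd ξ (s ∩ t) := by
  rcases hs.one_le.eq_or_lt with rfl | hξ
  · exact .basic _ (hs.isOpen.inter ht.isOpen)
  · obtain ⟨η, f, hη, hf, rfl⟩ := hs.exists_iUnion hξ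
    obtain ⟨θ, g, hθ, hg, rfl⟩ := ht.exists_iUnion hξ
    have : (⋃ n, f n) ∩ ⋃ n, g n = ⋃ k : ℕ, f k.unpair.1 ∩ g k.unpair.2 := by
      rw [Set.iUnion_unpair (fun i j => f i ∩ g j), iUnion_inter_iUnion]
    rw [this]
    refine .union ξ (fun k => max (η k.unpair.1) (θ k.unpair.2)) _ hξ
      (fun k => max_lt (hη _) (hθ _)) fun k => ?_
    rw [compl_inter]
    exact ((hf _).mono (le_max_left _ _)).union' ((hg _).mono (le_max_right _ _))

lemma image_of_isEmbedding [PseudoMetrizableSpace W] {ξ : Ordinal.{0}} {s : Set W'}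
    (hs : SigmaOrd ξ s) {f : W' → W} (hf : IsEmbedding f) (hr : SigmaOrd ξ (range f)) :
    SigmaOrd ξ (f '' s) := by
  obtain ⟨t, ht, rfl⟩ := hs.exists_preimage_eq hf.isInducing
  rw [image_preimage_eq_inter_range]
  exact ht.inter hr

/-- A countable-rank class `Σ⁰η` has a universal set, parametrized by the Baire space. -/
lemma exists_universal [SecondCountableTopology W] [PseudoMetrizableSpace W]
    (η : Ordinal.{0}) (h1 : 1 ≤ η) (hη : η.card ≤ Cardinal.aleph0) :
    ∃ A : Set ((ℕ → ℕ) × W), SigmaOrd η A ∧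
      ∀ s : Set W, SigmaOrd η s → ∃ z, s = {w | (z, w) ∈ A} := by
  induction η using WellFoundedLT.induction with
  | ind η ih =>
  rcases h1.eq_or_lt with rfl | h1
  · obtain ⟨b, hb⟩ := ((countable_countableBasis W).insert ∅).exists_eq_range (insert_nonempty _ _)
    have hbo (n) : IsOpen (b n) := by
      rcases (hb ▸ mem_range_self n : b n ∈ insert ∅ (countableBasis W)) with h | h
      · exact h ▸ isOpen_empty
      · exact isOpen_of_mem_countableBasis h
    let b' : ℕ → Set W := fun n => n.casesOn ∅ b
    have hb'o (n) : IsOpen (b' n) := by cases n; exacts [isOpen_empty, hbo _]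
    refine ⟨⋃ n : ℕ, ⋃ k : ℕ, {p | p.1 n = k ∧ p.2 ∈ b' k}, .basic _ ?_, fun s hs => ?_⟩
    · refine isOpen_iUnion fun n => isOpen_iUnion fun k => IsOpen.inter ?_ ?_
      · exact (isOpen_discrete ({k} : Set ℕ)).preimage
          (f := fun p : (ℕ → ℕ) × W => p.1 n) (by fun_prop)
      · exact (hb'o k).preimage continuous_snd
    · classical
      have hs := hs.isOpen
      refine ⟨fun n => if b n ⊆ s then n + 1 else 0, ?_⟩
      ext w
      simp only [mem_ofPred_eq, mem_iUnion, exists_eq_left']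
      constructor
      · intro hw
        obtain ⟨v, hv, hwv, hvs⟩ := (isBasis_countableBasis W).exists_subset_of_mem_open hw hs
        obtain ⟨n, rfl⟩ := hb ▸ mem_insert_of_mem ∅ hv
        exact ⟨n, by simpa [hvs, b'] using hwv⟩
      · rintro ⟨n, hn⟩
        split_ifs at hn with h
        exacts [h hn, hn.elim]
  · have hc : (Set.Ico 1 η).Countable := by
      refine Set.Countable.mono Set.Ico_subset_Iio_self ?_
      rw [← Cardinal.le_aleph0_iff_set_countable, Cardinal.mk_Iio_ordinal, Cardinal.lift_le_aleph0]
      exact hη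
    obtain ⟨e, he⟩ := hc.exists_eq_range ⟨1, le_rfl, h1⟩
    have hmem (n) : e n ∈ Set.Ico 1 η := by rw [he]; exact mem_range_self n
    choose A hA hAu using fun n => ih (e n) (hmem n).2 (hmem n).1
      ((Ordinal.card_le_card (hmem n).2.le).trans hη)
    refine ⟨⋃ n : ℕ, {p | ((fun k => p.1 (Nat.pair n k), p.2) : (ℕ → ℕ) × W) ∉ A n.unpair.1},
      .union η (fun n => e n.unpair.1) _ h1 (fun n => (hmem _).2) fun n => ?_, fun s hs => ?_⟩
    · simp only [compl_ofPred, not_not]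
      refine (hA n.unpair.1).preimage (f := fun p : (ℕ → ℕ) × W =>
        ((fun k => p.1 (Nat.pair n k), p.2) : (ℕ → ℕ) × W)) ?_
      fun_prop
    · obtain ⟨θ, f, hθ, hf, rfl⟩ := hs.exists_iUnion h1
      have hz : ∀ n : ℕ, ∃ z : ℕ → ℕ, (e n.unpair.1 = θ n.unpair.2 →
          (f n.unpair.2)ᶜ = {w | (z, w) ∈ A n.unpair.1}) ∧
          (e n.unpair.1 ≠ θ n.unpair.2 → univ = {w | (z, w) ∈ A n.unpair.1}) := by
        intro n
        by_cases h : e n.unpair.1 = θ n.unpair.2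
        · obtain ⟨z, hz⟩ := hAu n.unpair.1 (f n.unpair.2)ᶜ (h ▸ hf _)
          exact ⟨z, fun _ => hz, fun h' => absurd h h'⟩
        · obtain ⟨z, hz⟩ := hAu n.unpair.1 univ
            ((SigmaOrd.basic _ isOpen_univ).mono (hmem _).1)
          exact ⟨z, fun h' => absurd h' h, fun _ => hz⟩
      choose z hz1 hz2 using hz
      refine ⟨fun k => z k.unpair.1 k.unpair.2, ?_⟩
      ext w
      simp only [mem_ofPred_eq, mem_iUnion, Nat.unpair_pair]
      constructor
      · rintro ⟨m, hm⟩
        have : θ m ∈ Set.Ico 1 η := ⟨(hf m).one_le, hθ m⟩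
        obtain ⟨k, hk⟩ := he ▸ this
        refine ⟨Nat.pair k m, fun hw => ?_⟩
        have := hz1 (Nat.pair k m) (by simpa using hk)
        have hw' : w ∈ (f (Nat.pair k m).unpair.2)ᶜ := by rw [this]; exact hw
        simp at hw'
        exact hw' hm
      · rintro ⟨n, hn⟩
        by_cases h : e n.unpair.1 = θ n.unpair.2
        · refine ⟨n.unpair.2, by_contra fun hw => hn ?_⟩
          have : w ∈ (f n.unpair.2)ᶜ := hw
          rw [hz1 n h] at this
          exact this
        · have : w ∈ (univ : Set W) := trivial
          rw [hz2 n h] at this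
          exact absurd this hn

end SigmaOrd

/-- Inside every open set meeting `G` there are infinitely many disjoint small open sets meeting
`G`; if `lf` holds, they can be taken to form a locally finite family. -/
def HasSplitting {H : Type*} [MetricSpace H] (G : Set H) (lf : Prop) : Prop :=
  ∀ V O : Set H, IsOpen V → (G ∩ V).Nonempty → IsOpen O → G ⊆ O → ∀ ε : ENNReal, 0 < ε →
    ∃ V' : ℕ → Set H, (∀ n, IsOpen (V' n) ∧ (G ∩ V' n).Nonempty) ∧
      (∀ n, closure (V' n) ⊆ V ∩ O) ∧ (∀ n, Metric.ediam (V' n) ≤ ε) ∧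
      Pairwise (Function.onFun Disjoint V') ∧ (lf → LocallyFinite V')

section Scheme

variable {H : Type*} [MetricSpace H]

lemma exists_ball_of_mem_isOpen {V : Set H} (hV : IsOpen V) {x : H} (hx : x ∈ V) {ε : ENNReal}
    (hε : 0 < ε) {δ : ℝ} (hδ : 0 < δ) :
    ∃ r : ℝ, 0 < r ∧ r ≤ δ ∧ closure (Metric.ball x r) ⊆ V ∧
      Metric.ediam (Metric.ball x r) ≤ ε := by
  obtain ⟨r, hr, hrV⟩ := Metric.nhds_basis_closedBall.mem_iff.1 (hV.mem_nhds hx)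
  obtain ⟨e, he, heε⟩ : ∃ e : ℝ, 0 < e ∧ 2 * ENNReal.ofReal e ≤ ε := by
    rcases eq_or_ne ε ⊤ with rfl | h
    · exact ⟨1, one_pos, le_top⟩
    · refine ⟨ε.toReal / 2, half_pos (ENNReal.toReal_pos hε.ne' h), ?_⟩
      rw [← ENNReal.ofReal_ofNat, ← ENNReal.ofReal_mul (by norm_num), mul_div_cancel₀ _ two_ne_zero,
        ENNReal.ofReal_toReal h]
  refine ⟨min r (min e δ), by positivity, (min_le_right _ _).trans (min_le_right _ _), ?_, ?_⟩
  · exact Metric.closure_ball_subset_closedBall.trans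
      ((Metric.closedBall_subset_closedBall (min_le_left _ _)).trans hrV)
  · rw [← Metric.eball_ofReal]
    refine Metric.ediam_eball_le.trans (le_trans ?_ heε)
    gcongr
    exact (min_le_right _ _).trans (min_le_left _ _)

lemma hasSplitting_of_perfect (hperf : ∀ x : H, (𝓝[≠] x).NeBot) {G : Set H} (hG : Dense G) :
    HasSplitting G False := by
  intro V O hV hGV hO hGO ε hε
  obtain ⟨x, hxG, hxV⟩ := hGV
  have hVO := hV.inter hO
  have : Infinite ↥(V ∩ O) := by
    have := hperf x
    exact (infinite_of_mem_nhds x (hVO.mem_nhds ⟨hxV, hGO hxG⟩)).to_subtype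
  obtain ⟨U, hUi, hUo, hUd⟩ := exists_seq_infinite_isOpen_pairwise_disjoint ↥(V ∩ O)
  have hop (n) : IsOpen ((↑) '' U n : Set H) := hVO.isOpenMap_subtype_val _ (hUo n)
  choose g hgU hgG using fun n =>
    hG.inter_open_nonempty _ (hop n) ((hUi n).nonempty.image _)
  choose r hr _ hrU hrε using fun n => exists_ball_of_mem_isOpen (hop n) (hgU n) hε one_pos
  refine ⟨fun n => Metric.ball (g n) (r n),
    fun n => ⟨Metric.isOpen_ball, g n, hgG n, Metric.mem_ball_self (hr n)⟩, fun n => ?_, hrε, ?_,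
    False.elim⟩
  · refine (hrU n).trans ?_
    rintro _ ⟨y, -, rfl⟩
    exact y.2
  · intro m n hmn
    exact ((disjoint_image_iff Subtype.val_injective).2 (hUd hmn)).mono
      (subset_closure.trans (hrU m)) (subset_closure.trans (hrU n))

lemma hasSplitting_of_not_sigmaCompact [CompleteSpace H] {G : Set H}
    (hK : ∀ U : Set H, IsOpen U → (G ∩ U).Nonempty →
        ¬ ∃ K : ℕ → Set H, (∀ n, IsCompact (K n)) ∧ G ∩ U ⊆ ⋃ n, K n) :
    HasSplitting G True := by
  intro V O hV hGV hO hGO ε hε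
  have htb : ¬ TotallyBounded (G ∩ V) := fun h =>
    hK V hV hGV ⟨fun _ => closure (G ∩ V),
      fun _ => h.closure.isCompact_of_isClosed isClosed_closure,
      fun x hx => mem_iUnion.2 ⟨0, subset_closure hx⟩⟩
  simp only [Metric.totallyBounded_iff, not_forall, not_exists, not_and] at htb
  obtain ⟨δ, hδ, hfin⟩ := htb
  obtain ⟨x, hx, hxd⟩ := exists_seq_of_forall_finset_exists (fun y => y ∈ G ∩ V)
    (fun y z => δ ≤ dist z y) fun s _ => by
      obtain ⟨y, hy, hys⟩ := not_subset.1 (hfin s s.finite_toSet)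
      refine ⟨y, hy, fun z hz => ?_⟩
      simp only [mem_iUnion, not_exists, Metric.mem_ball, not_lt] at hys
      exact hys z hz
  have hxd' : ∀ m n, m ≠ n → δ ≤ dist (x m) (x n) := by
    intro m n hmn
    rcases hmn.lt_or_gt with h | h
    · rw [dist_comm]; exact hxd _ _ h
    · exact hxd _ _ h
  choose r hr hrδ hrU hrε using fun n => exists_ball_of_mem_isOpen (hV.inter hO)
    ⟨(hx n).2, hGO (hx n).1⟩ hε (show 0 < δ / 4 by positivity)
  refine ⟨fun n => Metric.ball (x n) (r n),
    fun n => ⟨Metric.isOpen_ball, x n, (hx n).1, Metric.mem_ball_self (hr n)⟩, hrU, hrε, ?_, ?_⟩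
  · intro m n hmn
    refine Metric.ball_disjoint_ball ?_
    linarith [hrδ m, hrδ n, hxd' m n hmn]
  · intro _ y
    refine ⟨Metric.ball y (δ / 4), Metric.ball_mem_nhds _ (by positivity), ?_⟩
    refine Set.Subsingleton.finite fun m hm n hn => by_contra fun hmn => ?_
    obtain ⟨a, ha, ha'⟩ := hm
    obtain ⟨b, hb, hb'⟩ := hn
    simp only [Metric.mem_ball] at ha ha' hb hb'
    have h1 := hxd' m n hmn
    have h2 := dist_triangle4_left (x m) (x n) a y
    have h3 := dist_triangle (x m) a y
    have h4 := dist_triangle (x n) b y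
    have h5 := dist_triangle_right (x m) (x n) y
    rw [dist_comm (x m) a] at h3
    rw [dist_comm (x n) b] at h4
    linarith [hrδ m, hrδ n]

open PiNat CantorScheme in
/-- A space with the splitting property contains nowhere dense copies of the Baire space inside
every open set. -/
lemma HasSplitting.exists_isEmbedding [CompleteSpace H] {G : Set H} {lf : Prop}
    (hs : HasSplitting G lf) (hGδ : IsGδ G) {U : Set H} (hU : IsOpen U)
    (hGU : (G ∩ U).Nonempty) :
    ∃ c : (ℕ → ℕ) → H, IsEmbedding c ∧ range c ⊆ G ∩ U ∧ IsGδ (range c) ∧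
      (lf → IsClosed (range c)) ∧ interior (closure (range c)) = ∅ := by
  obtain ⟨O, hO, hGO⟩ := isGδ_iff_eq_iInter_nat.1 hGδ
  have hGO' (n) : G ⊆ O n := hGO ▸ iInter_subset _ n
  have hpos (n : ℕ) : 0 < ((n : ENNReal)⁻¹) := by simp
  let T := {V : Set H // IsOpen V ∧ (G ∩ V).Nonempty}
  choose f hfo hfc hfd hfdisj hflf using fun (V : T) (n : ℕ) =>
    hs V.1 (O n) V.2.1 V.2.2 (hO n) (hGO' n) (n : ENNReal)⁻¹ (hpos n)
  let A' : List ℕ → T := fun l => l.rec ⟨U, hU, hGU⟩ fun a l V =>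
    ⟨f V l.length (a + 1), hfo V l.length (a + 1)⟩
  let A : List ℕ → Set H := fun l => (A' l).1
  have hAo (l) : IsOpen (A l) := (A' l).2.1
  have hAc (a l) : closure (A (a :: l)) ⊆ A l ∩ O l.length := hfc (A' l) l.length (a + 1)
  have hAanti (a l) : A (a :: l) ⊆ A l :=
    subset_closure.trans ((hAc a l).trans inter_subset_left)
  have hAd (a l) : Metric.ediam (A (a :: l)) ≤ (l.length : ENNReal)⁻¹ :=
    hfd (A' l) l.length (a + 1)
  have hAdisj (l a b) (h : a ≠ b) : Disjoint (A (a :: l)) (A (b :: l)) :=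
    hfdisj (A' l) l.length (by simpa using h)
  have hAlf (h : lf) (l) : LocallyFinite fun a => A (a :: l) :=
    (hflf (A' l) l.length h).comp_injective (add_left_injective 1)
  have hdisj : CantorScheme.Disjoint A := fun l a b h => hAdisj l a b h
  have hcanti : ClosureAntitone A := fun l a => (hAc a l).trans inter_subset_left
  have hvd : VanishingDiam A := by
    intro x
    rw [← tendsto_add_atTop_iff_nat 1]
    refine tendsto_of_tendsto_of_tendsto_of_le_of_le tendsto_const_nhds
      ENNReal.tendsto_inv_nat_nhds_zero (fun _ => zero_le) fun n => ?_
    simpa [res_succ, res_length] using hAd (x n) (res x n)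
  have hdom := hcanti.map_of_vanishingDiam hvd fun l => (A' l).2.2.mono inter_subset_right
  let c : (ℕ → ℕ) → H := fun x => (inducedMap A).2 ⟨x, hdom ▸ mem_univ x⟩
  have hcmem (x n) : c x ∈ A (res x n) := map_mem _ n
  have hcc : Continuous c := hvd.map_continuous.comp (by fun_prop)
  have hlen : ∀ l l' : List ℕ, l.length = l'.length → ∀ y, y ∈ A l → y ∈ A l' → l = l' := by
    intro l
    induction l with
    | nil => exact fun l' h _ _ _ => (List.length_eq_zero_iff.1 h.symm).symm
    | cons a l ih =>
      rintro (_ | ⟨b, l'⟩) h y hy hy'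
      · simp at h
      · obtain rfl := ih l' (by simpa using h) y (hAanti _ _ hy) (hAanti _ _ hy')
        by_contra hne
        exact disjoint_left.1 (hAdisj l a b (by simpa using hne)) hy hy'
  have hres (x) (l) (h : c x ∈ A l) : res x l.length = l :=
    hlen _ _ (res_length _ _) _ (hcmem x _) h
  have hsmall (x) (V : Set H) (hV : V ∈ 𝓝 (c x)) : ∃ n, A (res x n) ⊆ V := by
    obtain ⟨ε, hε, hεV⟩ := Metric.mem_nhds_iff.1 hV
    obtain ⟨n, hn⟩ := hvd.dist_lt ε hε x
    exact ⟨n, fun y hy => hεV (hn y hy _ (hcmem x n))⟩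
  have hinj : Function.Injective c := by
    intro x y hxy
    refine PiNat.res_injective (funext fun n => ?_)
    have := hres y (res x n) (hxy ▸ hcmem x n)
    rw [← this, res_length]
  have hrange : range c = ⋂ n : ℕ, ⋃ l ∈ {l : List ℕ | l.length = n}, A l := by
    refine Subset.antisymm ?_ fun y hy => ?_
    · rintro _ ⟨x, rfl⟩
      exact mem_iInter.2 fun n => mem_iUnion₂.2 ⟨res x n, res_length _ _, hcmem x n⟩
    · simp only [mem_iInter, mem_iUnion₂] at hy
      choose l hl hyl using hy
      have hl' (n) : ∃ a, l (n + 1) = a :: l n := by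
        rcases h : l (n + 1) with _ | ⟨a, l'⟩
        · have := hl (n + 1)
          rw [h] at this
          cases this
        · refine ⟨a, ?_⟩
          have h1 : l'.length = n := by
            have := hl (n + 1)
            rw [h] at this
            simpa using this
          rw [hlen l' (l n) (h1.trans (hl n).symm) y (hAanti a l' (h ▸ hyl (n + 1))) (hyl n)]
      choose x hx using hl'
      have hxl (n) : res x n = l n := by
        induction n with
        | zero => exact (List.length_eq_zero_iff.1 (hl 0)).symm
        | succ n ih => rw [hx, res_succ, ih]
      refine ⟨x, ?_⟩
      by_contra hne
      obtain ⟨n, hn⟩ := hvd.dist_lt (dist (c x) y) (dist_pos.2 hne) x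
      exact lt_irrefl _ (hn _ (hcmem x n) y (by rw [hxl]; exact hyl n))
  refine ⟨c, ⟨isInducing_iff_nhds.2 fun x => le_antisymm ?_ ?_, hinj⟩, ?_, ?_, ?_, ?_⟩
  · exact (hcc.tendsto x).le_comap
  · intro s hs
    obtain ⟨t, ⟨y, n, rfl⟩, hxt, hts⟩ :=
      (isTopologicalBasis_cylinders fun _ : ℕ => ℕ).mem_nhds_iff.1 hs
    refine ⟨A (res x n), (hAo _).mem_nhds (hcmem x n), fun z hz => hts ?_⟩
    have := hres z _ hz
    rw [res_length] at this
    rw [← mem_cylinder_iff_eq.1 hxt, cylinder_eq_res]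
    exact this
  · rintro _ ⟨x, rfl⟩
    refine ⟨?_, by simpa using hcmem x 0⟩
    rw [hGO, mem_iInter]
    intro n
    have := (hAc (x n) (res x n) (subset_closure (hcmem x (n + 1)))).2
    rwa [res_length] at this
  · rw [hrange]
    exact IsGδ.iInter fun n => (isOpen_biUnion fun l _ => hAo l).isGδ
  · intro h
    refine isClosed_of_closure_subset fun y hy => ?_
    have key (n : ℕ) : ∃ l : List ℕ, l.length = n ∧ y ∈ closure (range c ∩ A l) := by
      induction n with
      | zero =>
        have : range c ⊆ range c ∩ A [] := by
          rintro _ ⟨x, rfl⟩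
          exact ⟨mem_range_self x, hcmem x 0⟩
        exact ⟨[], rfl, closure_mono this hy⟩
      | succ n ih =>
        obtain ⟨l, hl, hyl⟩ := ih
        have : range c ∩ A l ⊆ ⋃ a, range c ∩ A (a :: l) := by
          rintro _ ⟨⟨x, rfl⟩, hx⟩
          have h1 := hcmem x (l.length + 1)
          rw [res_succ, hres x l hx] at h1
          exact mem_iUnion.2 ⟨_, mem_range_self x, h1⟩
        have h2 := closure_mono this hyl
        rw [((hAlf h l).subset fun a => inter_subset_right).closure_iUnion, mem_iUnion] at h2
        obtain ⟨a, ha⟩ := h2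
        exact ⟨a :: l, by simp [hl], ha⟩
    rw [hrange]
    refine mem_iInter.2 fun n => ?_
    obtain ⟨l, hl, hyl⟩ := key (n + 1)
    cases l with
    | nil => simp at hl
    | cons a l =>
      have hl' : l.length = n := by simpa using hl
      exact mem_iUnion₂.2 ⟨l, hl', (hAc a l (closure_mono inter_subset_right hyl)).1⟩
  · rw [eq_empty_iff_forall_notMem]
    intro y hy
    obtain ⟨_, hxI, x, rfl⟩ := mem_closure_iff.1 (interior_subset hy) _ isOpen_interior hy
    obtain ⟨n, hn⟩ := hsmall x _ (isOpen_interior.mem_nhds hxI)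
    let B := f (A' (res x n)) (res x n).length 0
    have hB := hfo (A' (res x n)) (res x n).length 0
    have hBA : B ⊆ A (res x n) :=
      subset_closure.trans ((hfc (A' (res x n)) (res x n).length 0).trans inter_subset_left)
    obtain ⟨z, hz⟩ := hB.2.mono inter_subset_right
    obtain ⟨_, hwB, w, rfl⟩ := mem_closure_iff.1 (interior_subset (hn (hBA hz))) B hB.1 hz
    have h1 := hres w _ (hBA hwB)
    rw [res_length] at h1
    have h2 := hcmem w (n + 1)
    rw [res_succ, h1] at h2
    exact disjoint_left.1 (hfdisj (A' (res x n)) (res x n).length (Nat.succ_ne_zero (w n)).symm)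
      hwB h2

end Scheme

/-- The sequence `s, α 0, α 1, …`. -/
def seqCons (s : ℕ) (α : ℕ → ℕ) : ℕ → ℕ := fun n => n.casesOn s α

@[simp] lemma seqCons_succ (s : ℕ) (α : ℕ → ℕ) (n : ℕ) : seqCons s α (n + 1) = α n := rfl

lemma seqCons_head_tail (α : ℕ → ℕ) : seqCons (α 0) (fun n => α (n + 1)) = α := by
  funext n
  cases n <;> rfl

lemma continuous_seqCons (s : ℕ) : Continuous (seqCons s) := by
  refine continuous_pi fun n => ?_
  cases n with
  | zero => exact continuous_const
  | succ n => exact continuous_apply n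

/-- A dense family of disjoint copies of the Baire space, indexed by the first coordinate. -/
lemma HasSplitting.exists_family {H : Type*} [MetricSpace H] [CompleteSpace H]
    [SecondCountableTopology H] [Nonempty H] {G : Set H} {lf : Prop}
    (hs : HasSplitting G lf) (hGδ : IsGδ G) (hG : Dense G) :
    ∃ c : (ℕ → ℕ) → H, Continuous c ∧ Function.Injective c ∧ range c ⊆ G ∧
      (∀ s, IsEmbedding fun α => c (seqCons s α)) ∧
      (∀ s, IsGδ (range fun α => c (seqCons s α))) ∧
      (lf → ∀ s, IsClosed (range fun α => c (seqCons s α))) ∧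
      ∀ O : Set H, IsOpen O → O.Nonempty → ∃ s, (range fun α => c (seqCons s α)) ⊆ O := by
  obtain ⟨b, hb⟩ := ((countable_countableBasis H).insert univ).exists_eq_range (insert_nonempty _ _)
  have hbo (n) : IsOpen (b n) ∧ (b n).Nonempty := by
    rcases (hb ▸ mem_range_self n : b n ∈ insert univ (countableBasis H)) with h | h
    · exact h ▸ ⟨isOpen_univ, univ_nonempty⟩
    · exact ⟨isOpen_of_mem_countableBasis h, nonempty_of_mem_countableBasis h⟩
  let T := {N : Set H // IsClosed N ∧ interior N = ∅}
  have hne (N : T) (s : ℕ) : (G ∩ (b s \ N.1)).Nonempty := by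
    rw [inter_comm]
    refine hG.inter_open_nonempty _ ((hbo s).1.sdiff N.2.1) (sdiff_nonempty.2 fun h => ?_)
    obtain ⟨x, hx⟩ := (hbo s).2
    have := mem_interior.2 ⟨_, h, (hbo s).1, hx⟩
    rwa [N.2.2] at this
  choose f hfe hfG hfδ hfc hfi using fun (N : T) (s : ℕ) =>
    hs.exists_isEmbedding hGδ ((hbo s).1.sdiff N.2.1) (hne N s)
  let N : ℕ → T := fun n => n.rec ⟨∅, isClosed_empty, interior_empty⟩ fun s N =>
    ⟨N.1 ∪ closure (range (f N s)), N.2.1.union isClosed_closure, by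
      rw [interior_union_isClosed_of_interior_empty N.2.1 (hfi N s), N.2.2]⟩
  have hN (s) : (N (s + 1)).1 = (N s).1 ∪ closure (range (f (N s) s)) := rfl
  have hNmono : Monotone fun s => (N s).1 :=
    monotone_nat_of_le_succ fun s => by rw [hN]; exact subset_union_left
  have hmem (s α) : f (N s) s α ∈ G ∩ (b s \ (N s).1) := hfG (N s) s (mem_range_self α)
  have hlt {s t α β} (h : s < t) : f (N s) s α ≠ f (N t) t β := fun heq => (hmem t β).2.2
    (hNmono (Nat.succ_le_of_lt h) (heq ▸ Or.inr (subset_closure (mem_range_self α))))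
  let c : (ℕ → ℕ) → H := fun α => f (N (α 0)) (α 0) fun n => α (n + 1)
  have hc (s) : (fun α => c (seqCons s α)) = f (N s) s := rfl
  refine ⟨c, ?_, ?_, ?_, fun s => ?_, fun s => ?_, fun h s => ?_, fun O hO hOne => ?_⟩
  · refine continuous_iff_continuousAt.2 fun α => ?_
    have h1 : Continuous fun β : ℕ → ℕ => f (N (α 0)) (α 0) fun n => β (n + 1) :=
      (hfe _ _).continuous.comp (by fun_prop)
    refine h1.continuousAt.congr ?_
    have h2 : {β : ℕ → ℕ | β 0 = α 0} ∈ 𝓝 α :=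
      (isOpen_discrete ({α 0} : Set ℕ)).preimage (f := fun β : ℕ → ℕ => β 0)
        (continuous_apply 0) |>.mem_nhds (mem_singleton _)
    filter_upwards [h2] with β hβ
    have hβ : β 0 = α 0 := hβ
    simp only [c, hβ]
  · intro α β h
    rcases lt_trichotomy (α 0) (β 0) with h0 | h0 | h0
    · exact absurd h (hlt h0)
    · have h1 : f (N (α 0)) (α 0) (fun n => α (n + 1)) = f (N (α 0)) (α 0) fun n => β (n + 1) := by
        simpa only [c, ← h0] using h
      rw [← seqCons_head_tail α, ← seqCons_head_tail β, h0, (hfe _ _).injective h1]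
    · exact absurd h.symm (hlt h0)
  · rintro _ ⟨α, rfl⟩
    exact (hmem _ _).1
  · rw [hc]; exact hfe _ _
  · rw [hc]; exact hfδ _ _
  · rw [hc]; exact hfc _ _ h
  · obtain ⟨x, hx⟩ := hOne
    obtain ⟨v, hv, -, hvO⟩ := (isBasis_countableBasis H).exists_subset_of_mem_open hx hO
    obtain ⟨s, rfl⟩ := hb ▸ mem_insert_of_mem univ hv
    refine ⟨s, ?_⟩
    rintro _ ⟨α, rfl⟩
    exact hvO (hmem s α).2.1

section Game

/-- The initial segment of length `n` of `α`. -/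
def initSeg (α : ℕ → ℕ) (n : ℕ) : List ℕ := List.ofFn fun i : Fin n => α i

@[simp] lemma length_initSeg (α : ℕ → ℕ) (n : ℕ) : (initSeg α n).length = n :=
  List.length_ofFn

lemma initSeg_succ (α : ℕ → ℕ) (n : ℕ) : initSeg α (n + 1) = initSeg α n ++ [α n] :=
  List.ofFn_succ_last

lemma initSeg_congr {α β : ℕ → ℕ} {n : ℕ} : initSeg α n = initSeg β n ↔ ∀ i < n, α i = β i := by
  rw [initSeg, initSeg, List.ofFn_inj, funext_iff, Fin.forall_iff]

lemma initSeg_eq_of_le {α β : ℕ → ℕ} {m n : ℕ} (hmn : m ≤ n) (h : initSeg α n = initSeg β n) :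
    initSeg α m = initSeg β m :=
  initSeg_congr.2 fun i hi => initSeg_congr.1 h i (hi.trans_le hmn)

lemma initSeg_prefix {α : ℕ → ℕ} {m n : ℕ} (hmn : m ≤ n) : initSeg α m <+: initSeg α n := by
  induction n, hmn using Nat.le_induction with
  | base => exact List.prefix_rfl
  | succ n _ ih => exact ih.trans (initSeg_succ α n ▸ List.prefix_append _ _)

lemma isOpen_setOf_initSeg_mem (n : ℕ) (S : Set (List ℕ)) : IsOpen {α | initSeg α n ∈ S} :=
  (isOpen_discrete {g : Fin n → ℕ | List.ofFn g ∈ S}).preimage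
    (f := fun (α : ℕ → ℕ) (i : Fin n) => α i) (by fun_prop)

lemma setOf_initSeg_eq_mem_nhds (α : ℕ → ℕ) (n : ℕ) : {β | initSeg β n = initSeg α n} ∈ 𝓝 α :=
  (isOpen_setOf_initSeg_mem n {initSeg α n}).mem_nhds rfl

/-- The answers of the strategy `T` along `α`. -/
def answers (T : List ℕ → Bool) (α : ℕ → ℕ) : ℕ → Bool := fun m => T (initSeg α (m + 1))

lemma continuous_answers :
    Continuous fun p : (List ℕ → Bool) × (ℕ → ℕ) => answers p.1 p.2 := by
  refine continuous_pi fun m => continuous_iff_continuousAt.2 fun p => ?_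
  have h1 : ContinuousAt (fun q : (List ℕ → Bool) × (ℕ → ℕ) => q.1 (initSeg p.2 (m + 1))) p := by
    fun_prop
  refine h1.congr ?_
  filter_upwards [continuous_snd.continuousAt (setOf_initSeg_eq_mem_nhds p.2 (m + 1))] with q hq
  have hq : initSeg q.2 (m + 1) = initSeg p.2 (m + 1) := hq
  rw [answers, hq]

/-- The bit sequence `r` takes the value `true` infinitely often. -/
def InfTrue (r : ℕ → Bool) : Prop := {m | r m = true}.Infinite

/-- The sequence coded by the positions of the value `true` in a bit sequence. -/
noncomputable def decodeBits (r : ℕ → Bool) : ℕ → ℕ :=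
  fun n => (Nat.unpair (Nat.nth (fun m => r m = true) n)).1

/-- The strategy of player I coded by `α`; the value `α 0` is irrelevant. -/
def codedStrategy (α : ℕ → ℕ) : List ℕ → ℕ := fun l => α (Encodable.encode l + 1)

/-- A sequence `β` is coded by the set of these positions, the `n`-th of which depends only on
`β 0, …, β n` and exceeds the code of `β 0, …, β (n - 1)`. -/
def codePosition (β : ℕ → ℕ) : ℕ → ℕ
  | 0 => Nat.pair (β 0) (Encodable.encode (initSeg β 0) + 1)
  | n + 1 => Nat.pair (β (n + 1))
      (codePosition β n + 1 + Encodable.encode (initSeg β (n + 1)) + 1)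

lemma unpair_codePosition (β : ℕ → ℕ) (n : ℕ) : (Nat.unpair (codePosition β n)).1 = β n := by
  cases n <;> simp [codePosition]

lemma codePosition_strictMono (β : ℕ → ℕ) : StrictMono (codePosition β) :=
  strictMono_nat_of_lt_succ fun n => by
    rw [codePosition]
    exact lt_of_lt_of_le (by omega) (Nat.right_le_pair _ _)

lemma encode_lt_codePosition (β : ℕ → ℕ) (n : ℕ) :
    Encodable.encode (initSeg β n) < codePosition β n := by
  cases n with
  | zero => exact lt_of_lt_of_le (Nat.lt_succ_self _) (Nat.right_le_pair _ _)
  | succ n =>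
    rw [codePosition]
    exact lt_of_lt_of_le (by omega) (Nat.right_le_pair _ _)

lemma codePosition_congr {β β' : ℕ → ℕ} {n : ℕ} (h : initSeg β (n + 1) = initSeg β' (n + 1)) :
    codePosition β n = codePosition β' n := by
  induction n with
  | zero => simp [codePosition, initSeg, initSeg_congr.1 h 0 zero_lt_one]
  | succ n ih =>
    have h' := initSeg_eq_of_le (Nat.le_succ (n + 1)) h
    rw [codePosition, codePosition, ih h', h', initSeg_congr.1 h (n + 1) (Nat.lt_succ_self _)]

open Classical in
/-- The bit sequence coding `β`. -/
noncomputable def codeBits (β : ℕ → ℕ) : ℕ → Bool := fun m => decide (m ∈ range (codePosition β))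

lemma setOf_codeBits (β : ℕ → ℕ) : {m | codeBits β m = true} = range (codePosition β) := by
  ext m
  simp [codeBits]

lemma infTrue_codeBits (β : ℕ → ℕ) : InfTrue (codeBits β) := by
  rw [InfTrue, setOf_codeBits]
  exact infinite_range_of_injective (codePosition_strictMono β).injective

lemma decodeBits_codeBits (β : ℕ → ℕ) : decodeBits (codeBits β) = β := by
  have : Nat.nth (fun m => codeBits β m = true) = codePosition β := by
    refine (StrictMono.range_inj (Nat.nth_strictMono (infTrue_codeBits β))
      (codePosition_strictMono β)).1 ?_
    rw [Nat.range_nth_of_infinite (infTrue_codeBits β), setOf_codeBits]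
  funext n
  rw [decodeBits, this, unpair_codePosition]

lemma codeBits_congr {β β' : ℕ → ℕ} {k m : ℕ} (h : initSeg β k = initSeg β' k)
    (hm : m ≤ Encodable.encode (initSeg β k)) : codeBits β m = codeBits β' m := by
  have key (γ γ' : ℕ → ℕ) (h : initSeg γ k = initSeg γ' k)
      (hm : m ≤ Encodable.encode (initSeg γ k)) (hmem : m ∈ range (codePosition γ)) :
      m ∈ range (codePosition γ') := by
    obtain ⟨n, rfl⟩ := hmem
    have hnk : n < k := (codePosition_strictMono γ).lt_iff_lt.1
      (hm.trans_lt (encode_lt_codePosition γ k))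
    exact ⟨n, (codePosition_congr (initSeg_eq_of_le hnk h)).symm⟩
  have : m ∈ range (codePosition β) ↔ m ∈ range (codePosition β') :=
    ⟨key _ _ h hm, key _ _ h.symm (h ▸ hm)⟩
  exact decide_eq_decide.2 this

/-- `T₀`, restricted to the initial segments of `a`, extends to a strategy which, together with
every sequence extending `a`, stays in `V`. -/
def Forces (V : Set ((List ℕ → Bool) × (ℕ → ℕ))) (a : List ℕ) (T₀ : List ℕ → Bool) : Prop :=
  ∃ T : List ℕ → Bool, (∀ l, l <+: a → T l = T₀ l) ∧
    ∀ T' : List ℕ → Bool, (∀ l, l <+: a ∨ a <+: l → T' l = T l) →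
      ∀ α, initSeg α a.length = a → (T', α) ∈ V

lemma Forces.of_forall_exists {V : Set ((List ℕ → Bool) × (ℕ → ℕ))} {a : List ℕ}
    {T₀ : List ℕ → Bool}
    (h : ∀ n, ∃ k, Forces V (a ++ [n]) (Function.update T₀ (a ++ [n]) k)) : Forces V a T₀ := by
  classical
  choose k T hT hTV using h
  refine ⟨fun l => if l <+: a then T₀ l else T (l.getD a.length 0) l,
    fun l hl => if_pos hl, fun T' hT' α hα => ?_⟩
  refine hTV (α a.length) T' (fun l hl => ?_) α ?_
  · by_cases hla : l <+: a
    · rw [hT' l (.inl hla), hT _ l (hla.trans (List.prefix_append _ _)),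
        Function.update_of_ne]
      · exact if_pos hla
      rintro rfl
      have := hla.length_le
      simp at this
    · have hal : a ++ [α a.length] <+: l := by
        rcases hl with hl | hl
        · rcases List.prefix_concat_iff.1 hl with rfl | hl
          · exact List.prefix_rfl
          · exact absurd hl hla
        · exact hl
      obtain ⟨t, rfl⟩ := hal
      rw [hT' _ (.inr ⟨[α a.length] ++ t, by simp⟩)]
      refine (if_neg hla).trans ?_
      simp
  · rw [List.length_append, List.length_singleton, initSeg_succ, hα]

/-- If player I does not win the game `B` and the open set `V` contains all pairs `(T, α)` such
that the answers of `T` along `α` beat the strategy coded by `α`, then some `T` stays in `V`. -/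
lemma exists_forall_mem_of_not_playerIWins {V : Set ((List ℕ → Bool) × (ℕ → ℕ))} (hV : IsOpen V)
    {B : Set (ℕ → ℕ)} (hB : ¬ PlayerIWins B)
    (h : ∀ T α, InfTrue (answers T α) →
      playI (codedStrategy α) (decodeBits (answers T α)) ∉ B → (T, α) ∈ V) :
    ∃ T, ∀ α, (T, α) ∈ V := by
  classical
  by_contra hcon
  have h0 : ¬ Forces V [] (fun _ => false) := by
    rintro ⟨T, -, hT⟩
    exact hcon ⟨T, fun α => hT T (fun _ _ => rfl) α rfl⟩
  have hstep (a T₀) (hf : ¬ Forces V a T₀) :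
      ∃ n, ∀ k, ¬ Forces V (a ++ [n]) (Function.update T₀ (a ++ [n]) k) := by
    by_contra hcon
    push Not at hcon
    exact hf (.of_forall_exists hcon)
  choose! ν hν using hstep
  let st : (ℕ → Bool) → ℕ → List ℕ × (List ℕ → Bool) := fun r m => m.rec ([], fun _ => false)
    fun m p => (p.1 ++ [ν p.1 p.2], Function.update p.2 (p.1 ++ [ν p.1 p.2]) (r m))
  let A : (ℕ → Bool) → ℕ → ℕ := fun r m => ν (st r m).1 (st r m).2
  have hst (r m) : st r (m + 1) =
    ((st r m).1 ++ [A r m], Function.update (st r m).2 ((st r m).1 ++ [A r m]) (r m)) := rfl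
  have hstF (r m) : ¬ Forces V (st r m).1 (st r m).2 := by
    induction m with
    | zero => exact h0
    | succ m ih => exact hν _ _ ih _
  have hst1 (r m) : (st r m).1 = initSeg (A r) m := by
    induction m with
    | zero => rfl
    | succ m ih => rw [hst, initSeg_succ, ih]
  have hst2 (r) (m j : ℕ) (hj : j < m) : (st r m).2 (initSeg (A r) (j + 1)) = r j := by
    induction m with
    | zero => omega
    | succ m ih =>
      rw [hst, hst1, ← initSeg_succ]
      rcases (Nat.lt_succ_iff.1 hj).eq_or_lt with rfl | hj
      · exact Function.update_self _ _ _
      · rw [← ih hj]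
        refine Function.update_of_ne (fun heq => ?_) _ _
        have := congrArg List.length heq
        simp at this
        omega
  have hloc (r r' : ℕ → Bool) (m) (hr : ∀ j < m, r j = r' j) : st r m = st r' m := by
    induction m with
    | zero => rfl
    | succ m ih =>
      have := ih fun j hj => hr j (hj.trans (Nat.lt_succ_self m))
      simp only [hst, A, this, hr m (Nat.lt_succ_self m)]
  have hkey (r : ℕ → Bool) (hr : InfTrue r) :
      playI (codedStrategy (A r)) (decodeBits r) ∈ B := by
    have hex (m) : ∃ p : (List ℕ → Bool) × (ℕ → ℕ), (∀ l, l <+: initSeg (A r) m →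
        p.1 l = (st r m).2 l) ∧ initSeg p.2 m = initSeg (A r) m ∧ p ∉ V := by
      have := hstF r m
      rw [Forces, hst1] at this
      push Not at this
      obtain ⟨T', hT', α, hα, hV⟩ := this (st r m).2 fun _ _ => rfl
      exact ⟨(T', α), fun l hl => hT' l (.inl hl), by simpa using hα, hV⟩
    choose p hpT hpα hpV using hex
    obtain ⟨T, -, φ, hφ, hlim⟩ := isCompact_univ.tendsto_subseq (x := fun m => (p m).1)
      fun _ => mem_univ _
    have hα : Tendsto (fun m => (p m).2) atTop (𝓝 (A r)) := by
      refine tendsto_pi_nhds.2 fun i => tendsto_const_nhds.congr' ?_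
      filter_upwards [eventually_gt_atTop i] with m hm
      exact (initSeg_congr.1 (hpα m) i hm).symm
    have hans : answers T (A r) = r := by
      funext j
      have h1 := (tendsto_pi_nhds.1 hlim (initSeg (A r) (j + 1)))
      refine tendsto_nhds_unique h1 (tendsto_const_nhds.congr' ?_)
      filter_upwards [eventually_gt_atTop j] with m hm
      have hm' : j < φ m := hm.trans_le (hφ.id_le m)
      exact ((hpT (φ m) _ (initSeg_prefix hm')).trans (hst2 r _ _ hm')).symm
    have hnV : (T, A r) ∉ V := hV.isClosed_compl.mem_of_tendsto
      (hlim.prodMk_nhds (hα.comp hφ.tendsto_atTop)) (Eventually.of_forall fun m => hpV (φ m))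
    by_contra hnB
    refine hnV (h T (A r) ?_ ?_) <;> rwa [hans]
  refine hB ⟨fun l => A (codeBits fun i => l.getD i 0) (Encodable.encode l + 1), fun β => ?_⟩
  convert hkey (codeBits β) (infTrue_codeBits β) using 1
  rw [decodeBits_codeBits]
  funext n
  unfold playI
  split_ifs
  · set l := List.ofFn fun i : Fin (n / 2) => β i with hl
    have hl' : l = initSeg β (n / 2) := rfl
    have hg : initSeg (fun i => l.getD i 0) (n / 2) = initSeg β (n / 2) := by
      rw [initSeg_congr]
      intro i hi
      simp [hl, hi]
    have := hloc (codeBits fun i => l.getD i 0) (codeBits β) (Encodable.encode l + 1)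
      fun j hj => codeBits_congr hg (by rw [hg, ← hl']; omega)
    simp only [codedStrategy, A, this]
  · rfl

end Game

section ZeroDim

lemma dimLE_zero_iff {Z : Type*} [TopologicalSpace Z] : DimLE Z 0 ↔
    ∀ (k : ℕ) (U : Fin k → Set Z), (∀ i, IsOpen (U i)) → (⋃ i, U i) = univ →
      ∃ V : Fin k → Set Z, (∀ i, IsOpen (V i)) ∧ (∀ i, V i ⊆ U i) ∧ (⋃ i, V i) = univ ∧
        Pairwise (Function.onFun Disjoint V) := by
  have key {k : ℕ} (V : Fin k → Set Z) : (∀ x : Z, ({i | x ∈ V i}).ncard ≤ 0 + 1) ↔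
      Pairwise (Function.onFun Disjoint V) := by
    simp only [zero_add, Set.ncard_le_one (toFinite _)]
    constructor
    · intro h i j hij
      exact disjoint_left.2 fun x hi hj => hij (h x i hi j hj)
    · intro h x i hi j hj
      by_contra hij
      exact disjoint_left.1 (h hij) hi hj
  simp only [DimLE, key]

/-- The clopen sets form a base of the topology. -/
def HasClopenBase (Z : Type*) [TopologicalSpace Z] : Prop :=
  ∀ x : Z, ∀ U, IsOpen U → x ∈ U → ∃ C, IsClopen C ∧ x ∈ C ∧ C ⊆ U

lemma DimLE.hasClopenBase {Z : Type*} [TopologicalSpace Z] [T1Space Z] (h : DimLE Z 0) :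
    HasClopenBase Z := by
  intro x U hU hx
  obtain ⟨V, hVo, hVU, hVc, hVd⟩ := dimLE_zero_iff.1 h 2 ![U, {x}ᶜ]
    (Fin.forall_fin_two.2 ⟨hU, isOpen_compl_singleton⟩) (by
      refine eq_univ_of_forall fun y => mem_iUnion.2 ?_
      by_cases hy : y = x
      · exact ⟨0, hy ▸ hx⟩
      · exact ⟨1, hy⟩)
  have h01 : V 0 = (V 1)ᶜ := by
    refine Subset.antisymm (hVd (by decide : (0 : Fin 2) ≠ 1)).subset_compl_right fun y hy => ?_
    obtain ⟨i, hi⟩ := mem_iUnion.1 (hVc ▸ mem_univ y)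
    fin_cases i
    · exact hi
    · exact absurd hi hy
  refine ⟨V 0, ⟨?_, hVo 0⟩, ?_, hVU 0⟩
  · rw [h01]
    exact (hVo 1).isClosed_compl
  · rw [h01]
    exact fun hx1 => hVU 1 hx1 rfl

lemma HasClopenBase.of_isInducing {Z Z' : Type*} [TopologicalSpace Z] [TopologicalSpace Z']
    (h : HasClopenBase Z) {f : Z' → Z} (hf : IsInducing f) : HasClopenBase Z' := by
  intro x U hU hx
  obtain ⟨t, ht, rfl⟩ := hf.isOpen_iff.1 hU
  obtain ⟨C, hC, hxC, hCt⟩ := h (f x) t ht hx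
  exact ⟨f ⁻¹' C, hC.preimage hf.continuous, hxC, preimage_mono hCt⟩

lemma HasClopenBase.prod {Z Z' : Type*} [TopologicalSpace Z] [TopologicalSpace Z']
    (h : HasClopenBase Z) (h' : HasClopenBase Z') : HasClopenBase (Z × Z') := by
  rintro ⟨x, y⟩ U hU hx
  obtain ⟨u, v, hu, hv, hxu, hyv, huv⟩ := isOpen_prod_iff.1 hU x y hx
  obtain ⟨C, hC, hxC, hCu⟩ := h x u hu hxu
  obtain ⟨D, hD, hyD, hDv⟩ := h' y v hv hyv
  exact ⟨C ×ˢ D, hC.prod hD, ⟨hxC, hyD⟩, (prod_mono hCu hDv).trans huv⟩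

lemma hasClopenBase_baire : HasClopenBase (ℕ → ℕ) := by
  intro x U hU hx
  obtain ⟨t, ⟨y, n, rfl⟩, hxt, htU⟩ :=
    (PiNat.isTopologicalBasis_cylinders fun _ : ℕ => ℕ).exists_subset_of_mem_open hx hU
  refine ⟨_, ⟨?_, PiNat.isOpen_cylinder _ y n⟩, hxt, htU⟩
  rw [PiNat.cylinder_eq_pi]
  exact isClosed_set_pi fun _ _ => isClosed_singleton

lemma HasClopenBase.dimLE {Z : Type*} [TopologicalSpace Z] [SecondCountableTopology Z]
    (h : HasClopenBase Z) : DimLE Z 0 := by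
  refine dimLE_zero_iff.2 fun k U hU hUc => ?_
  rcases isEmpty_or_nonempty Z with hZ | hZ
  · exact ⟨U, hU, fun _ => Subset.rfl, hUc, fun i j _ => disjoint_left.2 fun x => hZ.elim x⟩
  choose i hi using fun x => mem_iUnion.1 (hUc ▸ mem_univ x : x ∈ ⋃ i, U i)
  choose C hC hxC hCU using fun x => h x _ (hU (i x)) (hi x)
  obtain ⟨s, hs, hsC⟩ := TopologicalSpace.countable_cover_nhds fun x => (hC x).isOpen.mem_nhds (hxC x)
  have hsne : s.Nonempty := by
    by_contra hne
    rw [not_nonempty_iff_eq_empty.1 hne] at hsC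
    rw [biUnion_empty] at hsC
    exact empty_ne_univ hsC
  obtain ⟨x, rfl⟩ := hs.exists_eq_range hsne
  have hcov : ⋃ n, disjointed (fun n => C (x n)) n = univ := by
    rw [iUnion_disjointed, ← hsC, biUnion_range]
  refine ⟨fun j => ⋃ n ∈ {n | i (x n) = j}, disjointed (fun n => C (x n)) n, fun j => ?_,
    fun j => ?_, ?_, fun j j' hjj' => ?_⟩
  · exact isOpen_biUnion fun n _ => disjointedRec
      (fun t m ht => ht.sdiff (hC (x m)).isClosed) (hC (x n)).isOpen
  · refine iUnion₂_subset fun n hn => ?_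
    have hn : i (x n) = j := hn
    exact (disjointed_subset _ n).trans (hn ▸ hCU (x n))
  · refine eq_univ_of_forall fun y => ?_
    obtain ⟨n, hn⟩ := mem_iUnion.1 (hcov ▸ mem_univ y)
    exact mem_iUnion.2 ⟨i (x n), mem_iUnion₂.2 ⟨n, rfl, hn⟩⟩
  · refine disjoint_left.2 fun y hy hy' => ?_
    obtain ⟨n, hn, hyn⟩ := mem_iUnion₂.1 hy
    obtain ⟨n', hn', hyn'⟩ := mem_iUnion₂.1 hy'
    have : n = n' := by
      by_contra hne
      exact disjoint_left.1 (disjoint_disjointed _ hne) hyn hyn'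
    subst this
    exact hjj' (hn.symm.trans hn')

/-- Disjoint open sets of a subspace extend to disjoint open sets of the whole space. -/
lemma exists_disjoint_isOpen_extension {Y Z ι : Type*} [TopologicalSpace Y] [TopologicalSpace Z]
    [MetrizableSpace Z] {f : Y → Z} (hf : IsInducing f) {V : ι → Set Y}
    (hV : ∀ i, IsOpen (V i)) (hVd : Pairwise (Function.onFun Disjoint V)) :
    ∃ V' : ι → Set Z, (∀ i, IsOpen (V' i)) ∧ Pairwise (Function.onFun Disjoint V') ∧
      ∀ i, f ⁻¹' V' i = V i := by
  let := metrizableSpaceMetric Z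
  have hr (y : Y) (i : ι) (hy : y ∈ V i) :
      ∃ r : ℝ, 0 < r ∧ f ⁻¹' Metric.ball (f y) r ⊆ V i := by
    have := (hV i).mem_nhds hy
    rw [hf.nhds_eq_comap] at this
    exact (Metric.nhds_basis_ball.comap f).mem_iff.1 this
  choose! r hr0 hrV using hr
  refine ⟨fun i => ⋃ y ∈ V i, Metric.ball (f y) (r y i / 2),
    fun i => isOpen_biUnion fun _ _ => Metric.isOpen_ball, fun i j hij => ?_, fun i => ?_⟩
  · refine disjoint_left.2 fun z hz hz' => ?_
    obtain ⟨y, hy, hyz⟩ := mem_iUnion₂.1 hz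
    obtain ⟨y', hy', hyz'⟩ := mem_iUnion₂.1 hz'
    rw [Metric.mem_ball] at hyz hyz'
    have hd := dist_triangle_left (f y) (f y') z
    rcases le_total (r y i) (r y' j) with hle | hle
    · refine disjoint_left.1 (hVd hij) hy (hrV y' j hy' ?_)
      rw [mem_preimage, Metric.mem_ball]
      linarith
    · refine disjoint_left.1 (hVd hij) (hrV y i hy ?_) hy'
      rw [mem_preimage, Metric.mem_ball, dist_comm]
      linarith
  · refine Subset.antisymm (fun w hw => ?_) fun y hy => ?_
    · obtain ⟨y, hy, hyw⟩ := mem_iUnion₂.1 hw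
      exact hrV y i hy (Metric.ball_subset_ball (half_le_self (hr0 y i hy).le) hyw)
    · exact mem_iUnion₂.2 ⟨y, hy, Metric.mem_ball_self (half_pos (hr0 y i hy))⟩

/-- Adding isolated points to a zero-dimensional subspace preserves zero-dimensionality. -/
lemma DimLE.of_isolated {Z : Type*} [TopologicalSpace Z] [MetrizableSpace Z] {S : Set Z}
    (hS : DimLE ↥S 0) (hiso : ∀ z ∉ S, IsOpen {z}) : DimLE Z 0 := by
  refine dimLE_zero_iff.2 fun k U hU hUc => ?_
  obtain ⟨V, hVo, hVU, hVc, hVd⟩ := dimLE_zero_iff.1 hS k (fun i => Subtype.val ⁻¹' U i)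
    (fun i => (hU i).preimage continuous_subtype_val) (by rw [← preimage_iUnion, hUc, preimage_univ])
  obtain ⟨V', hV'o, hV'd, hV'V⟩ := exists_disjoint_isOpen_extension IsInducing.subtypeVal hVo hVd
  choose i hi using fun x => mem_iUnion.1 (hUc ▸ mem_univ x : x ∈ ⋃ i, U i)
  have hSV (z : Z) (hz : z ∈ S) : ∃ j, z ∈ V' j ∩ U j := by
    obtain ⟨j, hj⟩ := mem_iUnion.1 (hVc ▸ mem_univ (⟨z, hz⟩ : S))
    exact ⟨j, (hV'V j ▸ hj : _ ∈ Subtype.val ⁻¹' V' j), hVU j hj⟩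
  let R : Set Z := {z | ∀ j, z ∉ V' j ∩ U j}
  refine ⟨fun j => V' j ∩ U j ∪ {z | z ∈ R ∧ i z = j}, fun j => ?_, fun j => ?_, ?_,
    fun j j' hjj' => ?_⟩
  · refine ((hV'o j).inter (hU j)).union ?_
    rw [← biUnion_of_singleton {z | z ∈ R ∧ i z = j}]
    refine isOpen_biUnion fun z hz => hiso z fun hzS => ?_
    obtain ⟨j', hj'⟩ := hSV z hzS
    exact hz.1 j' hj'
  · rintro z (hz | ⟨-, rfl⟩)
    exacts [hz.2, hi z]
  · refine eq_univ_of_forall fun z => mem_iUnion.2 ?_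
    by_cases hz : z ∈ R
    · exact ⟨i z, .inr ⟨hz, rfl⟩⟩
    · simp only [R, mem_ofPred_eq, not_forall, not_not] at hz
      exact hz.imp fun j hj => .inl hj
  · refine disjoint_left.2 ?_
    rintro z (hz | ⟨hzR, rfl⟩) (hz' | ⟨hzR', rfl⟩)
    · exact disjoint_left.1 (hV'd hjj') hz.1 hz'.1
    · exact hzR' _ hz
    · exact hzR _ hz'
    · exact hjj' rfl

end ZeroDim

lemma exists_finite_net {X Y : Type*} [MetricSpace Y] [CompactSpace Y] (e : X → Y) (M : Set X)
    {ε : ℝ} (hε : 0 < ε) :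
    ∃ E : Set X, E.Finite ∧ E ⊆ M ∧ ∀ q ∈ M, ∃ p ∈ E, dist (e q) (e p) < ε := by
  have htb : TotallyBounded (e '' M) := isCompact_univ.totallyBounded.subset (subset_univ _)
  obtain ⟨E, hEM, hE, hMt⟩ := exists_subset_image_finite_and.1
    (Metric.finite_approx_of_totallyBounded htb ε hε)
  refine ⟨E, hE, hEM, fun q hq => ?_⟩
  obtain ⟨_, ⟨p, hp, rfl⟩, hqp⟩ := mem_iUnion₂.1 (hMt (mem_image_of_mem e hq))
  exact ⟨p, hp, hqp⟩

/-- Up to adding isolated points, the fibres of a continuous map from a closed subset of `X` to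
the Cantor space depend continuously on the base point, for every admissible topology. -/
lemma IsAdmissible.exists_continuous_fibre {X : Type*} [TopologicalSpace X] [T1Space X]
    {τ : TopologicalSpace (Cl X)} (hτ : IsAdmissible X τ) {Q : Set X} (hQ : IsClosed Q)
    {π : X → ℕ → Bool} (hπ : Continuous π) :
    ∃ φ : (ℕ → Bool) → Cl X, Continuous[_, τ] φ ∧ ∀ x, Q ∩ π ⁻¹' {x} ⊆ (φ x).1 ∧
      ∀ p ∈ (φ x).1, p ∉ Q ∩ π ⁻¹' {x} → ∃ O, IsOpen O ∧ O ∩ (φ x).1 = {p} := by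
  obtain ⟨Y, tY, _, _, e, he, rfl⟩ := hτ
  let := metrizableSpaceMetric Y
  choose E hEfin hEM hEd using fun (M : Set X) (n : ℕ) =>
    exists_finite_net e M (ε := 1 / ((n : ℝ) + 1)) Nat.one_div_pos_of_nat
  let M : (ℕ → Bool) → ℕ → Set X := fun x n => {p | p ∈ Q ∧ ∀ i < n, π p i = x i}
  have hMQ (x n) : M x n ⊆ Q := fun p hp => hp.1
  have hManti (x m n) (h : m ≤ n) : M x n ⊆ M x m := fun p hp =>
    ⟨hp.1, fun i hi => hp.2 i (hi.trans_le h)⟩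
  have hMcongr (x x' : ℕ → Bool) (n) (h : ∀ i < n, x i = x' i) : M x n = M x' n := by
    ext p
    exact and_congr_right fun _ => forall₂_congr fun i hi => by rw [h i hi]
  let S : (ℕ → Bool) → Set X := fun x => Q ∩ π ⁻¹' {x} ∪ ⋃ n, E (M x n) n
  have hfin (x p) (hp : p ∉ Q ∩ π ⁻¹' {x}) : ∃ O, IsOpen O ∧ p ∈ O ∧ (O ∩ S x).Finite := by
    by_cases hpQ : p ∈ Q
    · have hne : π p ≠ x := fun h => hp ⟨hpQ, h⟩
      obtain ⟨i, hi⟩ := Function.ne_iff.1 hne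
      refine ⟨{q | π q i ≠ x i}, ?_, hi, ?_⟩
      · exact (isOpen_discrete {b : Bool | b ≠ x i}).preimage (f := fun q => π q i) (by fun_prop)
      · refine Finite.subset (Set.Finite.biUnion (finite_Iic i) fun n _ => hEfin (M x n) n) ?_
        rintro q ⟨hqi, ⟨-, hq⟩ | hq⟩
        · exact absurd (congrFun hq i) hqi
        · obtain ⟨n, hn⟩ := mem_iUnion.1 hq
          refine mem_iUnion₂.2 ⟨n, ?_, hn⟩
          by_contra hni
          exact hqi ((hEM _ _ hn).2 i (not_le.1 hni))
    · refine ⟨Qᶜ, hQ.isOpen_compl, hpQ, ?_⟩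
      convert finite_empty
      refine eq_empty_of_forall_notMem ?_
      rintro q ⟨hqQ, ⟨hq, -⟩ | hq⟩
      · exact hqQ hq
      · obtain ⟨n, hn⟩ := mem_iUnion.1 hq
        exact hqQ (hMQ _ _ (hEM _ _ hn))
  have hSc (x) : IsClosed (S x) := by
    refine isOpen_compl_iff.1 (isOpen_iff_mem_nhds.2 fun p hp => ?_)
    obtain ⟨O, hO, hpO, hOf⟩ := hfin x p fun h => hp (.inl h)
    refine mem_of_superset ((hO.sdiff hOf.isClosed).mem_nhds ⟨hpO, fun h => hp h.2⟩) ?_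
    exact fun q hq hqS => hq.2 ⟨hq.1, hqS⟩
  have hnear (x x' : ℕ → Bool) (n : ℕ) (h : ∀ i < n, x i = x' i) (q) (hq : q ∈ S x) :
      ∃ p ∈ S x', dist (e q) (e p) < 1 / ((n : ℝ) + 1) := by
    have hqM : q ∈ M x' n → ∃ p ∈ S x', dist (e q) (e p) < 1 / ((n : ℝ) + 1) := fun hq => by
      obtain ⟨p, hp, hqp⟩ := hEd (M x' n) n q hq
      exact ⟨p, .inr (mem_iUnion.2 ⟨n, hp⟩), hqp⟩
    rcases hq with ⟨hqQ, hq⟩ | hq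
    · refine hqM ⟨hqQ, fun i hi => ?_⟩
      rw [← h i hi]
      exact congrFun hq i
    · obtain ⟨m, hm⟩ := mem_iUnion.1 hq
      rcases le_total n m with hnm | hmn
      · refine hqM (hMcongr x x' n h ▸ hManti _ _ _ hnm (hEM _ _ hm))
      · rw [hMcongr x x' m fun i hi => h i (hi.trans_le hmn)] at hm
        refine ⟨q, .inr (mem_iUnion.2 ⟨m, hm⟩), ?_⟩
        rw [dist_self]
        exact Nat.one_div_pos_of_nat
  have hnhds (x : ℕ → Bool) (n : ℕ) : {x' | ∀ i < n, x' i = x i} ∈ 𝓝 x :=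
    (PiNat.isOpen_cylinder _ x n).mem_nhds (PiNat.self_mem_cylinder x n)
  refine ⟨fun x => ⟨S x, hSc x⟩, ?_, fun x => ⟨subset_union_left, fun p hp hp' => ?_⟩⟩
  · refine continuous_induced_rng.2 (continuous_generateFrom_iff.2 ?_)
    rintro _ (⟨U, hU, rfl⟩ | ⟨U, hU, rfl⟩)
    · refine isOpen_iff_mem_nhds.2 fun x hx => ?_
      have hx : closure (e '' S x) ⊆ U := hx
      obtain ⟨δ, hδ, hδU⟩ := isClosed_closure.isCompact.exists_thickening_subset_open hU hx
      obtain ⟨n, hn⟩ := exists_nat_one_div_lt hδ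
      filter_upwards [hnhds x n] with x' hx'
      change closure (e '' S x') ⊆ U
      have h1 : e '' S x' ⊆ Metric.cthickening (1 / ((n : ℝ) + 1)) (e '' S x) := by
        rintro _ ⟨q, hq, rfl⟩
        obtain ⟨p, hp, hqp⟩ := hnear x' x n hx' q hq
        exact Metric.mem_cthickening_of_dist_le _ _ _ _ (mem_image_of_mem e hp) hqp.le
      refine (closure_minimal h1 Metric.isClosed_cthickening).trans (Subset.trans ?_ hδU)
      rw [← Metric.cthickening_closure]
      exact Metric.cthickening_subset_thickening' hδ hn _
    · refine isOpen_iff_mem_nhds.2 fun x hx => ?_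
      have hx : (closure (e '' S x) ∩ U).Nonempty := hx
      obtain ⟨_, hqU, q, hq, rfl⟩ := (closure_inter_open_nonempty_iff hU).1 hx |>.imp fun _ h => h.symm
      obtain ⟨δ, hδ, hδU⟩ := Metric.isOpen_iff.1 hU _ hqU
      obtain ⟨n, hn⟩ := exists_nat_one_div_lt hδ
      filter_upwards [hnhds x n] with x' hx'
      obtain ⟨p, hp, hqp⟩ := hnear x x' n (fun i hi => (hx' i hi).symm) q hq
      refine ⟨e p, subset_closure (mem_image_of_mem e hp), hδU ?_⟩
      rw [Metric.mem_ball, dist_comm]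
      exact hqp.trans hn
  · obtain ⟨O, hO, hpO, hOf⟩ := hfin x p hp'
    refine ⟨O \ ((O ∩ S x) \ {p}), hO.sdiff (hOf.subset sdiff_subset).isClosed, ?_⟩
    ext q
    constructor
    · rintro ⟨⟨hqO, hq⟩, hqS⟩
      by_contra hqp
      exact hq ⟨⟨hqO, hqS⟩, hqp⟩
    · rintro rfl
      exact ⟨⟨hpO, fun h => h.2 rfl⟩, hp⟩

section Coding

/-- The part of `ζ` coding a parameter of a universal set. -/
def paramPart (ζ : ℕ → ℕ) : ℕ → ℕ :=
  fun n => ζ (Denumerable.eqv (ℕ ⊕ ℕ ⊕ List ℕ) (.inl n))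

/-- The part of `ζ` coding a point of the Cantor space. -/
def pointPart (ζ : ℕ → ℕ) : ℕ → Bool :=
  fun n => decide (ζ (Denumerable.eqv (ℕ ⊕ ℕ ⊕ List ℕ) (.inr (.inl n))) ≠ 0)

/-- The part of `ζ` coding a map which produces answers to finite sequences. -/
def answerPart (ζ : ℕ → ℕ) : List ℕ → Bool :=
  fun l => decide (ζ (Denumerable.eqv (ℕ ⊕ ℕ ⊕ List ℕ) (.inr (.inr l))) ≠ 0)

/-- The sequence with prescribed parts. -/
def joinParts (z : ℕ → ℕ) (x : ℕ → Bool) (T : List ℕ → Bool) : ℕ → ℕ := fun k =>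
  Sum.elim z (Sum.elim (fun n => (x n).toNat) fun l => (T l).toNat)
    ((Denumerable.eqv (ℕ ⊕ ℕ ⊕ List ℕ)).symm k)

@[simp] lemma paramPart_joinParts (z : ℕ → ℕ) (x : ℕ → Bool) (T : List ℕ → Bool) :
    paramPart (joinParts z x T) = z := by
  funext n
  simp [paramPart, joinParts]

@[simp] lemma pointPart_joinParts (z : ℕ → ℕ) (x : ℕ → Bool) (T : List ℕ → Bool) :
    pointPart (joinParts z x T) = x := by
  funext n
  cases h : x n <;> simp [pointPart, joinParts, h]

@[simp] lemma answerPart_joinParts (z : ℕ → ℕ) (x : ℕ → Bool) (T : List ℕ → Bool) :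
    answerPart (joinParts z x T) = T := by
  funext l
  cases h : T l <;> simp [answerPart, joinParts, h]

lemma continuous_paramPart : Continuous paramPart := continuous_pi fun _ => continuous_apply _

lemma continuous_pointPart : Continuous pointPart := continuous_pi fun _ =>
  (continuous_of_discreteTopology (f := fun k : ℕ => decide (k ≠ 0))).comp (continuous_apply _)

lemma continuous_answerPart : Continuous answerPart := continuous_pi fun _ =>
  (continuous_of_discreteTopology (f := fun k : ℕ => decide (k ≠ 0))).comp (continuous_apply _)

lemma continuous_joinParts (z : ℕ → ℕ) (x : ℕ → Bool) : Continuous (joinParts z x) := by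
  refine continuous_pi fun k => ?_
  rcases h : (Denumerable.eqv (ℕ ⊕ ℕ ⊕ List ℕ)).symm k with n | n | l
  · simpa [joinParts, h] using continuous_const
  · simpa [joinParts, h] using continuous_const
  · have : Continuous fun T : List ℕ → Bool => (T l).toNat :=
      (continuous_of_discreteTopology (f := Bool.toNat)).comp (continuous_apply l)
    simpa [joinParts, h] using this

lemma continuous_playI_codedStrategy :
    Continuous fun p : (ℕ → ℕ) × (ℕ → ℕ) => playI (codedStrategy p.1) p.2 := by
  refine continuous_pi fun n => ?_
  by_cases hn : n % 2 = 0
  · have : (fun p : (ℕ → ℕ) × (ℕ → ℕ) => playI (codedStrategy p.1) p.2 n) =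
        fun p => p.1 (Encodable.encode (initSeg p.2 (n / 2)) + 1) := by
      funext p
      simp [playI, hn, codedStrategy, initSeg]
    rw [this]
    refine continuous_iff_continuousAt.2 fun p => ?_
    have h1 : ContinuousAt (fun q : (ℕ → ℕ) × (ℕ → ℕ) =>
        q.1 (Encodable.encode (initSeg p.2 (n / 2)) + 1)) p := by fun_prop
    refine h1.congr ?_
    filter_upwards [continuous_snd.continuousAt (setOf_initSeg_eq_mem_nhds p.2 (n / 2))] with q hq
    have hq : initSeg q.2 (n / 2) = initSeg p.2 (n / 2) := hq
    rw [hq]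
  · simp only [playI, hn, if_false]
    fun_prop

lemma continuousAt_decodeBits {r : ℕ → Bool} (hr : InfTrue r) : ContinuousAt decodeBits r := by
  refine continuousAt_pi.2 fun n => ?_
  refine continuousAt_const.congr (f := fun _ => decodeBits r n) ?_
  set K := Nat.nth (fun m => r m = true) n with hK
  filter_upwards [(PiNat.isOpen_cylinder _ r (K + 1)).mem_nhds (PiNat.self_mem_cylinder r _)]
    with r' hr'
  have hr' : ∀ m < K + 1, r' m = r m := hr'
  have h1 : Nat.count (fun m => r' m = true) K = n := by
    rw [← Nat.count_nth_of_infinite hr n, ← hK, Nat.count_eq_card_filter_range,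
      Nat.count_eq_card_filter_range]
    refine congrArg Finset.card (Finset.filter_congr fun m hm => ?_)
    rw [hr' m ((Finset.mem_range.1 hm).trans (Nat.lt_succ_self K))]
  have h2 : r' K = true := by
    rw [hr' K (Nat.lt_succ_self K)]
    exact Nat.nth_mem_of_infinite hr n
  have h3 : Nat.nth (fun m => r' m = true) n = K := by
    conv_lhs => rw [← h1]
    exact Nat.nth_count h2
  rw [decodeBits, decodeBits, h3]

/-- The pairs `(ζ, α)` such that the strategy of player I coded by `α` does not lose against the
answers coded by `ζ`, in the game given by the set `U` and the remaining data in `ζ`. -/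
def notLosing (U : Set ((ℕ → ℕ) × (ℕ → Bool) × (ℕ → ℕ))) : Set ((ℕ → ℕ) × (ℕ → ℕ)) :=
  {p | InfTrue (answers (answerPart p.1) p.2) → (paramPart p.1, pointPart p.1,
    playI (codedStrategy p.2) (decodeBits (answers (answerPart p.1) p.2))) ∈ U}

lemma SigmaOrd.notLosing {ξ : Ordinal.{0}} (hξ : 2 ≤ ξ)
    {U : Set ((ℕ → ℕ) × (ℕ → Bool) × (ℕ → ℕ))} (hU : SigmaOrd ξ U) :
    SigmaOrd ξ (notLosing U) := by
  let r : (ℕ → ℕ) × (ℕ → ℕ) → ℕ → Bool := fun p => answers (answerPart p.1) p.2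
  have hr : Continuous r := continuous_answers.comp
    ((continuous_answerPart.comp continuous_fst).prodMk continuous_snd)
  let I : Set ((ℕ → ℕ) × (ℕ → ℕ)) := {p | InfTrue (r p)}
  have hI : SigmaOrd ξ Iᶜ := by
    have : Iᶜ = ⋃ N : ℕ, ⋂ m : ℕ, {p | N < m → r p m = false} := by
      ext p
      rw [mem_compl_iff, mem_iUnion]
      refine (not_congr Nat.frequently_atTop_iff_infinite.symm).trans ?_
      simp only [not_frequently, eventually_atTop, mem_iInter, mem_ofPred_eq, Bool.not_eq_true]
      exact ⟨fun ⟨N, hN⟩ => ⟨N, fun m hm => hN m hm.le⟩, fun ⟨N, hN⟩ => ⟨N + 1, fun m hm => hN m hm⟩⟩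
    rw [this]
    refine (SigmaOrd.of_isClosed_iUnion fun N => isClosed_iInter fun m => ?_).mono hξ
    exact (isClosed_discrete {b : Bool | N < m → b = false}).preimage (f := fun p => r p m)
      (by fun_prop)
  let g : (ℕ → ℕ) × (ℕ → ℕ) → (ℕ → ℕ) × (ℕ → Bool) × (ℕ → ℕ) := fun p =>
    (paramPart p.1, pointPart p.1, playI (codedStrategy p.2) (decodeBits (r p)))
  have hg : ContinuousOn g I := by
    intro p hp
    refine ContinuousAt.continuousWithinAt ?_
    have h1 : ContinuousAt (fun p => decodeBits (r p)) p :=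
      (continuousAt_decodeBits hp).comp_of_eq hr.continuousAt rfl
    refine (continuous_paramPart.comp continuous_fst).continuousAt.prodMk
      ((continuous_pointPart.comp continuous_fst).continuousAt.prodMk ?_)
    exact continuous_playI_codedStrategy.continuousAt.comp (continuousAt_snd.prodMk h1)
  obtain ⟨t, ht, htg⟩ := (hU.preimage (continuousOn_iff_continuous_domRestrict.1 hg)).exists_preimage_eq
    IsInducing.subtypeVal
  have : _root_.notLosing U = Iᶜ ∪ t := by
    ext p
    by_cases hp : p ∈ I
    · have h1 : p ∈ t ↔ g p ∈ U := by
        have : (⟨p, hp⟩ : I) ∈ Subtype.val ⁻¹' t ↔ (⟨p, hp⟩ : I) ∈ I.domRestrict g ⁻¹' U := by rw [htg]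
        exact this
      have h2 : p ∈ _root_.notLosing U ↔ g p ∈ U := ⟨fun h => h hp, fun h _ => h⟩
      rw [h2, ← h1]
      simp [hp]
    · have h2 : p ∈ _root_.notLosing U := fun h => absurd h hp
      simp [h2, hp]
  rw [this]
  exact hI.union' ht

end Coding

section Reduction

/-- The points `(ζ, h)` such that `h` is no `c α` for a strategy `α` of player I which does not
lose against the answers coded by `ζ`. -/
def losingSet {H : Type*} (U : Set ((ℕ → ℕ) × (ℕ → Bool) × (ℕ → ℕ))) (c : (ℕ → ℕ) → H) :
    Set ((ℕ → ℕ) × H) :=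
  {q | ∀ α, c α = q.2 → (q.1, α) ∉ notLosing U}

lemma sigmaOrd_compl_losingSet {H : Type*} [TopologicalSpace H] [MetrizableSpace H]
    {ξ : Ordinal.{0}} (hξ : 2 ≤ ξ) {U : Set ((ℕ → ℕ) × (ℕ → Bool) × (ℕ → ℕ))}
    (hU : SigmaOrd ξ U) {c : (ℕ → ℕ) → H} (hemb : ∀ s, IsEmbedding fun α => c (seqCons s α))
    (hrange : ∀ s, SigmaOrd ξ (range fun α => c (seqCons s α))) :
    SigmaOrd ξ (losingSet U c)ᶜ := by
  have : (losingSet U c)ᶜ = ⋃ s, (Prod.map id fun α => c (seqCons s α)) ''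
      ((Prod.map id (seqCons s)) ⁻¹' notLosing U) := by
    ext ⟨ζ, h⟩
    simp only [losingSet, mem_compl_iff, mem_ofPred_eq, mem_iUnion, mem_image, mem_preimage,
      Prod.exists, Prod.map_apply, id_eq, Prod.mk.injEq]
    push Not
    constructor
    · rintro ⟨α, rfl, hα⟩
      exact ⟨α 0, ζ, fun n => α (n + 1), by rwa [seqCons_head_tail], rfl, by rw [seqCons_head_tail]⟩
    · rintro ⟨s, ζ, α, hα, rfl, rfl⟩
      exact ⟨_, rfl, hα⟩
  rw [this]
  refine SigmaOrd.iUnion fun s => ?_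
  refine ((hU.notLosing hξ).preimage
    (continuous_id.prodMap (continuous_seqCons s))).image_of_isEmbedding
    (IsEmbedding.id.prodMap (hemb s)) ?_
  rw [range_prodMap, range_id, univ_prod]
  exact (hrange s).preimage continuous_snd

variable {H : Type*} [TopologicalSpace H] [PolishSpace H] {ξ : Ordinal.{0}}
  {U : Set ((ℕ → ℕ) × (ℕ → Bool) × (ℕ → ℕ))} {c : (ℕ → ℕ) → H} {z : ℕ → ℕ} {x : ℕ → Bool}
  {F : Set ↥(losingSet U c)}

lemma dimLE_of_playerIWins {G : Set H}
    (hD : ∀ D : Set H, D ⊆ G → G ⊆ closure D → DimLE (↥(Dᶜ)) 0) (hcG : range c ⊆ G)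
    (hcd : ∀ O : Set H, IsOpen O → O.Nonempty → ∃ s, (range fun α => c (seqCons s α)) ⊆ O)
    (hiso : ∀ p ∈ F, ¬ (paramPart p.1.1 = z ∧ pointPart p.1.1 = x) →
      ∃ O, IsOpen O ∧ O ∩ F = {p})
    (hwin : PlayerIWins {γ | (z, x, γ) ∈ U}) : DimLE ↥F 0 := by
  obtain ⟨σ, hσ⟩ := hwin
  let a : ℕ → ℕ := fun n => σ (Denumerable.ofNat (List ℕ) n)
  have ha (s) : codedStrategy (seqCons s a) = σ := by
    funext l
    simp [codedStrategy, a]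
  let D : Set H := range fun s => c (seqCons s a)
  have hDG : D ⊆ G := range_subset_iff.2 fun s => hcG (mem_range_self _)
  have hDd : Dense D := dense_iff_inter_open.2 fun O hO hOn => by
    obtain ⟨s, hs⟩ := hcd O hO hOn
    exact ⟨_, hs (mem_range_self a), mem_range_self s⟩
  have hbase := hasClopenBase_baire.prod
    (hD D hDG (by rw [hDd.closure_eq]; exact subset_univ _)).hasClopenBase
  let S : Set ↥F := {p | paramPart p.1.1.1 = z ∧ pointPart p.1.1.1 = x}
  have hS (p : S) : p.1.1.1.2 ∈ Dᶜ := by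
    rintro ⟨s, hs⟩
    have hp := p.1.1.2 _ hs
    refine hp fun _ => ?_
    rw [p.2.1, p.2.2, ha]
    exact hσ _
  let f : S → (ℕ → ℕ) × ↥Dᶜ := fun p => (p.1.1.1.1, ⟨p.1.1.1.2, hS p⟩)
  have hf : IsInducing f := by
    refine IsInducing.of_comp (g := Prod.map id Subtype.val) (by fun_prop) (by fun_prop) ?_
    exact IsInducing.subtypeVal.comp (IsInducing.subtypeVal.comp IsInducing.subtypeVal)
  refine DimLE.of_isolated (S := S) (hbase.of_isInducing hf).dimLE fun p hp => ?_
  obtain ⟨O, hO, hOF⟩ := hiso p.1 p.2 hp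
  convert hO.preimage (continuous_subtype_val (p := (· ∈ F)))
  ext q
  rw [mem_singleton_iff, mem_preimage, Subtype.ext_iff, ← mem_singleton_iff, ← hOF]
  exact and_iff_left q.2

lemma dimLE_of_not_playerIWins (hc : Continuous c) (hinj : Function.Injective c)
    (hF : ∀ p, paramPart p.1.1 = z → pointPart p.1.1 = x → p ∈ F)
    (hdim : DimLE ↥F 0) (hwin : ¬ PlayerIWins {γ | (z, x, γ) ∈ U}) : DimLE H 0 := by
  refine dimLE_zero_iff.2 fun k u hu huc => ?_
  have hι : IsInducing fun p : ↥F => p.1.1 := IsInducing.subtypeVal.comp IsInducing.subtypeVal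
  obtain ⟨v, hvo, hvu, hvc, hvd⟩ := dimLE_zero_iff.1 hdim k (fun i => (fun p => p.1.1.2) ⁻¹' u i)
    (fun i => (hu i).preimage (continuous_snd.comp hι.continuous))
    (by rw [← preimage_iUnion, huc, preimage_univ])
  obtain ⟨v', hv'o, hv'd, hv'v⟩ := exists_disjoint_isOpen_extension hι hvo hvd
  let w : Fin k → Set ((ℕ → ℕ) × H) := fun i => v' i ∩ Prod.snd ⁻¹' u i
  have hwo (i) : IsOpen (w i) := (hv'o i).inter ((hu i).preimage continuous_snd)
  have hFw (p) (hp : p ∈ F) : p.1 ∈ ⋃ i, w i := by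
    obtain ⟨i, hi⟩ := mem_iUnion.1 (hvc ▸ mem_univ (⟨p, hp⟩ : ↥F))
    refine mem_iUnion.2 ⟨i, ?_, hvu i hi⟩
    rw [← hv'v i] at hi
    exact hi
  have hXw (T) (h : H) (hT : (joinParts z x T, h) ∈ losingSet U c) :
      (joinParts z x T, h) ∈ ⋃ i, w i :=
    hFw ⟨_, hT⟩ (hF _ (paramPart_joinParts _ _ _) (pointPart_joinParts _ _ _))
  obtain ⟨T, hT⟩ := exists_forall_mem_of_not_playerIWins
    (V := (fun p => (joinParts z x p.1, c p.2)) ⁻¹' ⋃ i, w i)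
    ((isOpen_iUnion hwo).preimage (((continuous_joinParts z x).comp continuous_fst).prodMk
      (hc.comp continuous_snd))) hwin fun T α hinf hplay => by
    refine hXw T _ fun α' hα' hn => hplay ?_
    obtain rfl := hinj hα'
    simpa using hn (by simpa using hinf)
  have hTw (h : H) : (joinParts z x T, h) ∈ ⋃ i, w i := by
    by_cases hh : h ∈ range c
    · obtain ⟨α, rfl⟩ := hh
      exact hT α
    · exact hXw T h fun α hα => absurd ⟨α, hα⟩ hh
  refine ⟨fun i => (fun h => (joinParts z x T, h)) ⁻¹' w i,
    fun i => (hwo i).preimage (by fun_prop), fun i h hh => hh.2, ?_, fun i j hij => ?_⟩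
  · rw [← preimage_iUnion]
    exact eq_univ_of_forall hTw
  · exact ((hv'd hij).mono inter_subset_left inter_subset_left).preimage _

lemma exists_gameSigmaHard (hdim : ¬ DimLE H 0) {G : Set H}
    (hD : ∀ D : Set H, D ⊆ G → G ⊆ closure D → DimLE (↥(Dᶜ)) 0)
    (hξ : 2 ≤ ξ) (hξc : ξ.card ≤ Cardinal.aleph0)
    (hc : Continuous c) (hinj : Function.Injective c) (hcG : range c ⊆ G)
    (hemb : ∀ s, IsEmbedding fun α => c (seqCons s α))
    (hrange : ∀ s, SigmaOrd ξ (range fun α => c (seqCons s α)))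
    (hcd : ∀ O : Set H, IsOpen O → O.Nonempty → ∃ s, (range fun α => c (seqCons s α)) ⊆ O) :
    ∃ X : Set ((ℕ → ℕ) × H), SigmaOrd ξ Xᶜ ∧
      ∀ τ : TopologicalSpace (Cl ↥X), IsAdmissible (↥X) τ → @GameSigmaHard ξ _ τ (F0 ↥X) := by
  obtain ⟨U, hU, hUu⟩ := SigmaOrd.exists_universal (W := (ℕ → Bool) × (ℕ → ℕ)) ξ
    (one_le_two.trans hξ) hξc
  refine ⟨losingSet U c, sigmaOrd_compl_losingSet hξ hU hemb hrange, fun τ hτ A' => ?_⟩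
  rintro ⟨B, hB, rfl⟩
  obtain ⟨z, rfl⟩ := hUu B hB
  have hζ : Continuous fun p : ↥(losingSet U c) => p.1.1 := by fun_prop
  obtain ⟨φ, hφ, hφF⟩ := hτ.exists_continuous_fibre
    (isClosed_singleton.preimage (continuous_paramPart.comp hζ) (t := {z}))
    (continuous_pointPart.comp hζ)
  refine ⟨φ, hφ, ?_⟩
  ext x
  refine ⟨dimLE_of_playerIWins hD hcG hcd (hφF x).2, fun h => ?_⟩
  by_contra hwin
  exact hdim (dimLE_of_not_playerIWins hc hinj (fun p hz hx => (hφF x).1 ⟨hz, hx⟩) h hwin)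

end Reduction

/-- Let `H` be a perfect non-zero-dimensional Polish space and `G` a dense `G_δ` subset of
`H` such that for every dense subset `D` of `G` the space `H ∖ D` is zero-dimensional.
Then for every countable ordinal `ξ ≥ 3` there exists a `Π⁰ξ` set `X ⊆ ω^ω × H` such
that `F₀(X)` is `Game Σ⁰ξ`-hard; and if moreover `G` is nowhere relatively `σ`-compact in
`H`, the same conclusion holds for `ξ = 2`. -/
theorem F0_gameSigmaXi_hard_of_denseGdelta {H : Type*} [TopologicalSpace H] [PolishSpace H]
    (hperf : ∀ x : H, Filter.NeBot (nhdsWithin x {x}ᶜ))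
    (hdim : ¬ DimLE H 0)
    (G : Set H) (hGδ : IsGδ G) (hdense : Dense G)
    (hD : ∀ D : Set H, D ⊆ G → G ⊆ closure D → DimLE (↥(Dᶜ)) 0) :
    (∀ ξ : Ordinal.{0}, ξ.card ≤ Cardinal.aleph0 → 3 ≤ ξ →
      ∃ X : Set ((ℕ → ℕ) × H),
        SigmaOrd ξ Xᶜ ∧
        ∀ τ : TopologicalSpace (Cl ↥X), IsAdmissible (↥X) τ →
          @GameSigmaHard ξ _ τ (F0 ↥X)) ∧
    ((∀ U : Set H, IsOpen U → (G ∩ U).Nonempty →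
        ¬ ∃ K : ℕ → Set H, (∀ n, IsCompact (K n)) ∧ G ∩ U ⊆ ⋃ n, K n) →
      ∃ X : Set ((ℕ → ℕ) × H),
        SigmaOrd 2 Xᶜ ∧
        ∀ τ : TopologicalSpace (Cl ↥X), IsAdmissible (↥X) τ →
          @GameSigmaHard 2 _ τ (F0 ↥X)) := by
  have : Nonempty H := by
    by_contra hH
    rw [not_nonempty_iff] at hH
    exact hdim fun k U hU hUc => ⟨U, hU, fun _ => Subset.rfl, hUc, isEmptyElim⟩
  let := upgradeIsCompletelyMetrizable H
  refine ⟨fun ξ hξc hξ => ?_, fun hK => ?_⟩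
  · obtain ⟨c, hc, hinj, hcG, hemb, hrange, -, hcd⟩ :=
      (hasSplitting_of_perfect hperf hdense).exists_family hGδ hdense
    have h23 : (2 : Ordinal.{0}) ≤ 3 := by norm_num
    exact exists_gameSigmaHard hdim hD (h23.trans hξ) hξc hc hinj hcG hemb
      (fun s => (SigmaOrd.of_isGδ (hrange s)).mono hξ) hcd
  · obtain ⟨c, hc, hinj, hcG, hemb, -, hrange, hcd⟩ :=
      (hasSplitting_of_not_sigmaCompact hK).exists_family hGδ hdense
    have h2 : (2 : Ordinal.{0}).card ≤ Cardinal.aleph0 := by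
      simp
    exact exists_gameSigmaHard hdim hD le_rfl h2 hc hinj hcG hemb
      (fun s => SigmaOrd.of_isClosed (hrange trivial s)) hcd
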